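/- (Key velocity estimate, Lemma 2.1, φ-component.) There exists a universal constant C₁ ≥ 1 with the following property. Let ω : S² → ℝ be bounded measurable and odd-odd symmetric, and for r > 0 let M_r ∈ [0,∞] denote the Lipschitz constant of ω̃ restricted to [0,r]×[0,r]. Then for every (φ,θ) ∈ [0,1]²∖{(0,0)}, writing x = x(φ,θ), | u(x)·e_φ(x) + (x₂/√(1−x₃²)) · (4/π) ∫_{Q(3φ/2, 3θ/2)} (y₂ y₃ / |y−x₀|⁴) ω(y) dσ(y) | ≤ (x₂/√(1−x₃²)) · C₁ · min{ ‖ω‖_{L∞} (1 + ln(1 + θ/φ)), ‖ω‖_{L∞} + M_{3θ/2} · θ }. -/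

import Mathlib

open MeasureTheory Real Filter Set
open scoped ENNReal NNReal

noncomputable section

abbrev E3 : Type := EuclideanSpace ℝ (Fin 3)

/-- The vector `(a, b, c)` in `ℝ³`. -/
def vec3 (a b c : ℝ) : E3 := (WithLp.equiv 2 (Fin 3 → ℝ)).symm ![a, b, c]

/-- Euclidean dot product in `ℝ³`. -/
def dot3 (x y : E3) : ℝ := x 0 * y 0 + x 1 * y 1 + x 2 * y 2

/-- Cross product in `ℝ³`. -/
def cross3 (x y : E3) : E3 :=
  vec3 (x 1 * y 2 - x 2 * y 1) (x 2 * y 0 - x 0 * y 2) (x 0 * y 1 - x 1 * y 0)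

/-- The unit sphere `S²` in `ℝ³`. -/
def S2 : Set E3 := Metric.sphere (0 : E3) 1

/-- The surface measure on `S²`: the 2-dimensional Hausdorff measure restricted to `S²`. -/
def sigma2 : Measure E3 := (μH[2] : Measure E3).restrict S2

/-- Spherical coordinates. -/
def sc (φ θ : ℝ) : E3 := vec3 (cos θ * cos φ) (cos θ * sin φ) (sin θ)

/-- The Biot–Savart velocity of a vorticity `ω` on the sphere. -/
def biotSavart (ω : E3 → ℝ) (x : E3) : E3 :=
  (2 * Real.pi)⁻¹ • ∫ y, (‖x - y‖ ^ 2)⁻¹ • ω y • cross3 x y ∂sigma2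

/-- The unit tangent vector `e_φ`. -/
def ephi (y : E3) : E3 := vec3 (-(y 1) / sqrt (1 - (y 2) ^ 2)) (y 0 / sqrt (1 - (y 2) ^ 2)) 0

/-- The unit tangent vector `e_θ`. -/
def etheta (y : E3) : E3 :=
  vec3 (-(y 2) * y 0 / sqrt (1 - (y 2) ^ 2)) (-(y 2) * y 1 / sqrt (1 - (y 2) ^ 2))
    (sqrt (1 - (y 2) ^ 2))

/-- Reflection in the second coordinate: `ỹ`. -/
def flip2 (y : E3) : E3 := vec3 (y 0) (-(y 1)) (y 2)

/-- Reflection in the third coordinate: `ȳ`. -/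
def flip3 (y : E3) : E3 := vec3 (y 0) (y 1) (-(y 2))

/-- `ω` is odd-odd symmetric on the sphere. -/
def OddOdd (ω : E3 → ℝ) : Prop := ∀ x ∈ S2, ω (flip2 x) = -ω x ∧ ω (flip3 x) = -ω x

def x₀ : E3 := vec3 1 0 0

/-- The region `Q(k₁, k₂)` on the sphere. -/
def Qset (k₁ k₂ : ℝ) : Set E3 :=
  (fun p : ℝ × ℝ => sc p.1 p.2) '' (Ioo k₁ Real.pi ×ˢ Ioo k₂ (Real.pi / 2))

/-- The open quarter sphere. -/
def S2q : Set E3 := {y ∈ S2 | 0 < y 1 ∧ 0 < y 2}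

/-- The (possibly infinite) Lipschitz constant of `f` on the set `s`. -/
def lipOn (f : ℝ × ℝ → ℝ) (s : Set (ℝ × ℝ)) : ℝ≥0∞ :=
  ⨆ p ∈ s, ⨆ q ∈ s, edist (f p) (f q) / edist p q


@[simp] lemma vec3_0 (a b c : ℝ) : vec3 a b c 0 = a := rfl
@[simp] lemma vec3_1 (a b c : ℝ) : vec3 a b c 1 = b := rfl
@[simp] lemma vec3_2 (a b c : ℝ) : vec3 a b c 2 = c := rfl

lemma E3_ext {x y : E3} (h0 : x 0 = y 0) (h1 : x 1 = y 1) (h2 : x 2 = y 2) : x = y := by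
  ext i; fin_cases i <;> assumption

lemma nsq (x : E3) : ‖x‖ ^ 2 = x 0 ^ 2 + x 1 ^ 2 + x 2 ^ 2 := by
  rw [EuclideanSpace.real_norm_sq_eq, Fin.sum_univ_three]

lemma nsq_sub (x y : E3) : ‖x - y‖ ^ 2 = (x 0 - y 0) ^ 2 + (x 1 - y 1) ^ 2 + (x 2 - y 2) ^ 2 := by
  rw [nsq]; simp

lemma mem_S2 {x : E3} : x ∈ S2 ↔ x 0 ^ 2 + x 1 ^ 2 + x 2 ^ 2 = 1 := by
  rw [← nsq, S2, mem_sphere_zero_iff_norm]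
  constructor
  · intro h; rw [h]; norm_num
  · intro h
    nlinarith [norm_nonneg x]

lemma sc_mem (a b : ℝ) : sc a b ∈ S2 := by
  rw [mem_S2]; simp only [sc, vec3_0, vec3_1, vec3_2]
  nlinarith [sin_sq_add_cos_sq a, sin_sq_add_cos_sq b]

lemma sc_dist (φ θ α β : ℝ) : ‖sc φ θ - sc α β‖ ^ 2 =
    4 * sin ((θ - β) / 2) ^ 2 + 4 * (cos θ * cos β) * sin ((φ - α) / 2) ^ 2 := by
  rw [nsq_sub]; simp only [sc, vec3_0, vec3_1, vec3_2]
  have h1 : sin ((θ - β) / 2) ^ 2 = 1/2 - cos (θ - β) / 2 := by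
    rw [sin_sq_eq_half_sub]; congr 2; ring_nf
  have h2 : sin ((φ - α) / 2) ^ 2 = 1/2 - cos (φ - α) / 2 := by
    rw [sin_sq_eq_half_sub]; congr 2; ring_nf
  rw [h1, h2, cos_sub, cos_sub]
  have e1 := sin_sq_add_cos_sq θ
  have e2 := sin_sq_add_cos_sq β
  have e3 := sin_sq_add_cos_sq φ
  have e4 := sin_sq_add_cos_sq α
  linear_combination (cos θ ^ 2) * e3 + (cos β ^ 2) * e4 + e1 + e2

lemma sin_lb {t : ℝ} (ht : |t| ≤ (π + 1) / 2) : (t / 4) ^ 2 ≤ sin t ^ 2 := by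
  wlog h0 : 0 ≤ t with H
  · have := @H (-t) (by rwa [abs_neg]) (by linarith)
    simpa [neg_div] using this
  rw [abs_of_nonneg h0] at ht
  have hp := pi_gt_three
  have hp4 := pi_lt_four
  have : t / 4 ≤ sin t := by
    rcases le_or_gt t (π / 2) with h | h
    · have := mul_le_sin h0 h
      refine le_trans ?_ this
      have : (1:ℝ)/4 ≤ 2 / π := by rw [div_le_div_iff₀ (by norm_num) (by positivity)]; linarith
      nlinarith
    · have h1 : π - t ≤ π / 2 := by linarith
      have := mul_le_sin (by linarith : 0 ≤ π - t) h1
      rw [sin_pi_sub] at this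
      refine le_trans ?_ this
      have h2 : (2:ℝ) / π * (π - t) = 2 - 2 * t / π := by field_simp
      rw [h2]
      have : 2 * t / π ≤ 4 / 3 := by
        rw [div_le_div_iff₀ (by positivity) (by norm_num)]; linarith
      linarith [show t ≤ 2.1 by linarith [pi_lt_d2]]
  nlinarith

lemma dist_lb {φ θ α β : ℝ} (hφ : φ ∈ Icc (0:ℝ) 1) (hθ : θ ∈ Icc (0:ℝ) 1)
    (hα : |α| ≤ π) (hβ : |β| ≤ π / 2) :
    (1 / 100000) * ((φ - α) ^ 2 + (θ - β) ^ 2) ≤ ‖sc φ θ - sc α β‖ ^ 2 := by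
  obtain ⟨h1, h2⟩ := hφ
  obtain ⟨h3, h4⟩ := hθ
  have hp := pi_gt_three
  have hp4 := pi_lt_four
  rw [sc_dist]
  have a1 := abs_le.1 hα
  have b1 := abs_le.1 hβ
  have s1 := @sin_lb ((θ - β) / 2) (by rw [abs_le]; constructor <;> linarith)
  have s2 := @sin_lb ((φ - α) / 2) (by rw [abs_le]; constructor <;> linarith)
  have c1 : 1/2 ≤ cos θ := by
    have := one_sub_sq_div_two_le_cos (x := θ); nlinarith
  have c2 : 0 ≤ cos β := cos_nonneg_of_mem_Icc ⟨by linarith, b1.2⟩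
  have u2 : (φ - α) ^ 2 ≤ 25 := by nlinarith
  have u1 : (θ - β) ^ 2 ≤ 9 := by nlinarith
  have p2 := sq_nonneg (sin ((φ - α) / 2))
  rcases le_or_gt |β| (5/4) with h | h
  · have b2 := abs_le.1 h
    have c3 : 1/5 ≤ cos β := by
      have := one_sub_sq_div_two_le_cos (x := β); nlinarith
    have : 1/10 ≤ cos θ * cos β := by nlinarith
    nlinarith
  · have : (1/4)^2 ≤ (θ - β) ^ 2 := by
      rcases lt_abs.1 h with h | h <;> nlinarith
    have : 0 ≤ cos θ * cos β := by positivity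
    have := mul_nonneg this p2
    nlinarith


lemma flip2_sc (a b : ℝ) : flip2 (sc a b) = sc (-a) b := by
  apply E3_ext <;> simp [flip2, sc]

lemma flip3_sc (a b : ℝ) : flip3 (sc a b) = sc a (-b) := by
  apply E3_ext <;> simp [flip3, sc]

lemma S2_sub : S2 ⊆ (fun p : ℝ × ℝ => sc p.1 p.2) '' (Icc (-π) π ×ˢ Icc (-(π / 2)) (π / 2)) := by
  intro y hy
  rw [mem_S2] at hy
  set z : ℂ := ⟨y 0, y 1⟩ with hz
  have hr : ‖z‖ = sqrt (1 - y 2 ^ 2) := by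
    rw [← Real.sqrt_sq (norm_nonneg z), Complex.sq_norm, Complex.normSq_apply]
    congr 1; simp only [hz]; linarith
  refine ⟨(Complex.arg z, arcsin (y 2)), ⟨⟨(Complex.neg_pi_lt_arg z).le, Complex.arg_le_pi z⟩,
    ⟨neg_pi_div_two_le_arcsin _, arcsin_le_pi_div_two _⟩⟩, ?_⟩
  have e0 := Complex.norm_mul_cos_arg z
  have e1 := Complex.norm_mul_sin_arg z
  apply E3_ext
  · simp only [sc, vec3_0]; rw [cos_arcsin, ← hr, e0]
  · simp only [sc, vec3_1]; rw [cos_arcsin, ← hr, e1]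
  · simp only [sc, vec3_2]; rw [sin_arcsin] <;> nlinarith [sq_nonneg (y 0), sq_nonneg (y 1)]

lemma S2q_eq : S2q = (fun p : ℝ × ℝ => sc p.1 p.2) '' (Ioo 0 π ×ˢ Ioo 0 (π / 2)) := by
  ext y
  constructor
  · rintro ⟨hy, h1, h2⟩
    obtain ⟨⟨a, b⟩, ⟨⟨ha1, ha2⟩, hb1, hb2⟩, rfl⟩ := S2_sub hy
    simp only [sc, vec3_1, vec3_2] at *
    have hc : 0 ≤ cos b := cos_nonneg_of_mem_Icc ⟨hb1, hb2⟩
    have hs : 0 < sin a := pos_of_mul_pos_right h1 hc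
    have hc : 0 < cos b := pos_of_mul_pos_left h1 hs.le
    refine ⟨(a, b), ⟨⟨?_, ?_⟩, ?_, ?_⟩, rfl⟩
    · by_contra h
      have := sin_nonpos_of_nonpos_of_neg_pi_le (not_lt.1 h) ha1
      linarith
    · refine lt_of_le_of_ne ha2 ?_
      rintro rfl
      simp at hs
    · by_contra h
      have := sin_nonpos_of_nonpos_of_neg_pi_le (not_lt.1 h) (by linarith [pi_pos])
      linarith
    · refine lt_of_le_of_ne hb2 ?_
      rintro rfl
      simp at hc
  · rintro ⟨⟨a, b⟩, ⟨⟨ha1, ha2⟩, hb1, hb2⟩, rfl⟩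
    simp only at *
    refine ⟨sc_mem _ _, ?_, ?_⟩
    · simp only [sc, vec3_1]
      exact mul_pos (cos_pos_of_mem_Ioo ⟨by linarith, hb2⟩) (sin_pos_of_pos_of_lt_pi ha1 ha2)
    · simp only [sc, vec3_2]
      exact sin_pos_of_pos_of_lt_pi hb1 (by linarith)

lemma sc_lip : LipschitzWith 2 (fun p : ℝ × ℝ => sc p.1 p.2) := by
  apply LipschitzWith.of_dist_le_mul
  rintro ⟨a, b⟩ ⟨a', b'⟩
  rw [dist_eq_norm, Prod.dist_eq]
  apply le_of_sq_le_sq _ (by positivity)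
  rw [sc_dist]
  simp only [Real.dist_eq]
  have h1 : sin ((b - b') / 2) ^ 2 ≤ ((b - b') / 2) ^ 2 := sq_le_sq.2 (abs_sin_le_abs)
  have h2 : sin ((a - a') / 2) ^ 2 ≤ ((a - a') / 2) ^ 2 := sq_le_sq.2 (abs_sin_le_abs)
  have h3 : cos b * cos b' ≤ 1 := by
    have := abs_mul (cos b) (cos b')
    have h := mul_le_mul (abs_cos_le_one b) (abs_cos_le_one b') (abs_nonneg _) zero_le_one
    linarith [le_abs_self (cos b * cos b')]
  have m1 : (a - a') ^ 2 ≤ (max |a - a'| |b - b'|) ^ 2 := by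
    rw [← sq_abs]; gcongr; exact le_max_left _ _
  have m2 : (b - b') ^ 2 ≤ (max |a - a'| |b - b'|) ^ 2 := by
    rw [← sq_abs]; gcongr; exact le_max_right _ _
  have := mul_le_mul_of_nonneg_right h3 (sq_nonneg (sin ((a - a') / 2)))
  simp only [NNReal.coe_ofNat]
  nlinarith

lemma sc_meas : Measurable (fun p : ℝ × ℝ => sc p.1 p.2) := sc_lip.continuous.measurable

lemma sigma_le (A : Set (ℝ × ℝ)) :
    sigma2.restrict ((fun p : ℝ × ℝ => sc p.1 p.2) '' A) ≤
      (4 : ℝ≥0∞) • (volume.restrict A).map (fun p : ℝ × ℝ => sc p.1 p.2) := by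
  refine Measure.le_iff.2 fun T hT => ?_
  rw [Measure.restrict_apply hT, Measure.smul_apply, Measure.map_apply sc_meas hT,
    Measure.restrict_apply (sc_meas hT)]
  have h1 : T ∩ (fun p : ℝ × ℝ => sc p.1 p.2) '' A
    = (fun p : ℝ × ℝ => sc p.1 p.2) '' ((fun p : ℝ × ℝ => sc p.1 p.2) ⁻¹' T ∩ A) := by
    rw [Set.image_preimage_inter]
  rw [h1]
  refine (Measure.restrict_apply_le _ _).trans ?_
  refine (sc_lip.hausdorffMeasure_image_le (d := 2) (by norm_num) _).trans ?_
  rw [hausdorffMeasure_prod_real]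
  norm_num

lemma lint_le (A : Set (ℝ × ℝ)) (f : E3 → ℝ≥0∞) (hf : Measurable f) :
    ∫⁻ y in (fun p : ℝ × ℝ => sc p.1 p.2) '' A, f y ∂sigma2 ≤
      4 * ∫⁻ p in A, f (sc p.1 p.2) := by
  refine (lintegral_mono' (sigma_le A) le_rfl).trans ?_
  rw [lintegral_smul_measure, lintegral_map hf sc_meas]
  rfl

lemma arct (a t : ℝ) : ∫⁻ α : ℝ, ENNReal.ofReal (|t| / ((a - α) ^ 2 + t ^ 2)) ≤ ENNReal.ofReal π := by
  rw [lintegral_sub_left_eq_self (fun α : ℝ => ENNReal.ofReal (|t| / (α ^ 2 + t ^ 2))) a]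
  rcases eq_or_ne t 0 with rfl | ht
  · simp
  have ht' : 0 < |t| := abs_pos.2 ht
  have e : ∀ α : ℝ, |t| / (α ^ 2 + t ^ 2) = |t|⁻¹ * (1 + (|t|⁻¹ * α) ^ 2)⁻¹ := by
    intro α
    have : α ^ 2 + t ^ 2 = |t| ^ 2 * (1 + (|t|⁻¹ * α) ^ 2) := by
      rw [mul_pow, ← sq_abs t]; field_simp; ring
    rw [this]
    have h : (1 + (|t|⁻¹ * α) ^ 2) ≠ 0 := by positivity
    field_simp
  simp_rw [e]
  have hi : Integrable (fun α : ℝ => |t|⁻¹ * (1 + (|t|⁻¹ * α) ^ 2)⁻¹) :=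
    ((integrable_inv_one_add_sq).comp_mul_left' (inv_ne_zero ht'.ne')).const_mul _
  rw [← ofReal_integral_eq_lintegral_ofReal hi (ae_of_all _ fun α => by positivity)]
  apply ENNReal.ofReal_le_ofReal
  rw [integral_const_mul, Measure.integral_comp_mul_left (fun x : ℝ => (1 + x ^ 2)⁻¹),
    integral_univ_inv_one_add_sq]
  rw [inv_inv, abs_abs, smul_eq_mul, inv_mul_cancel_left₀ ht'.ne']

lemma invsq {k t : ℝ} (h : 0 < k + t) :
    ∫⁻ α in Ioi k, ENNReal.ofReal (1 / (α + t) ^ 2) ≤ ENNReal.ofReal (1 / (k + t)) := by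
  have hd : ∀ x ∈ Ici k, HasDerivAt (fun x : ℝ => - (x + t)⁻¹) (1 / (x + t) ^ 2) x := by
    intro x hx
    have hx : k ≤ x := hx
    have h0 : x + t ≠ 0 := by linarith
    have := (((hasDerivAt_id' x).add_const t).inv h0).neg
    rw [neg_div, neg_neg] at this
    exact this
  have hl : Tendsto (fun x : ℝ => - (x + t)⁻¹) atTop (nhds 0) := by
    have := (tendsto_inv_atTop_zero.comp (tendsto_atTop_add_const_right atTop t tendsto_id)).neg
    simpa using this
  have hp : ∀ x ∈ Ioi k, 0 ≤ 1 / (x + t) ^ 2 := fun x _ => by positivity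
  have hi := integrableOn_Ioi_deriv_of_nonneg' hd hp hl
  rw [← ofReal_integral_eq_lintegral_ofReal hi (ae_of_all _ fun α => by positivity),
    integral_Ioi_of_hasDerivAt_of_nonneg' hd hp hl]
  simp

lemma logint {φ θ : ℝ} (hφ : 0 < φ) (hθ : 0 ≤ θ) :
    ∫⁻ β in Ioc 0 (3 * θ / 2), ENNReal.ofReal (1 / (φ + |β - θ|)) ≤
      ENNReal.ofReal (2 * log (1 + θ / φ)) := by
  have hc : Continuous (fun β : ℝ => 1 / (φ + |β - θ|)) := by
    refine continuous_const.div (by fun_prop) fun x => by positivity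
  have hle : (0:ℝ) ≤ 3 * θ / 2 := by linarith
  have hii : ∀ a b : ℝ, IntervalIntegrable (fun β : ℝ => 1 / (φ + |β - θ|)) volume a b :=
    fun a b => hc.intervalIntegrable a b
  rw [← ofReal_integral_eq_lintegral_ofReal ((intervalIntegrable_iff_integrableOn_Ioc_of_le hle).1
    (hii _ _)) (ae_of_all _ fun α => by positivity)]
  apply ENNReal.ofReal_le_ofReal
  rw [← intervalIntegral.integral_of_le hle,
    ← intervalIntegral.integral_add_adjacent_intervals (hii 0 θ) (hii θ _)]
  have e1 : ∫ β in (0:ℝ)..θ, 1 / (φ + |β - θ|) = log (1 + θ / φ) := by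
    have : ∫ β in (0:ℝ)..θ, 1 / (φ + |β - θ|) = ∫ β in (0:ℝ)..θ, (fun u => u⁻¹) (φ + θ - β) := by
      apply intervalIntegral.integral_congr
      intro β hβ
      rw [uIcc_of_le hθ] at hβ
      simp only
      rw [abs_of_nonpos (by linarith [hβ.2])]
      rw [one_div]; congr 1; ring
    rw [this, intervalIntegral.integral_comp_sub_left (fun u : ℝ => u⁻¹), integral_inv_of_pos
      (by linarith) (by linarith)]
    rw [sub_zero, add_sub_cancel_right]
    congr 1; field_simp
  have e2 : ∫ β in θ..(3 * θ / 2), 1 / (φ + |β - θ|) ≤ log (1 + θ / φ) := by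
    have : ∫ β in θ..(3 * θ / 2), 1 / (φ + |β - θ|) = ∫ β in θ..(3 * θ / 2), (fun u => u⁻¹) (β - (θ - φ)) := by
      apply intervalIntegral.integral_congr
      intro β hβ
      rw [uIcc_of_le (by linarith)] at hβ
      simp only
      rw [abs_of_nonneg (by linarith [hβ.1])]
      rw [one_div]; congr 1; ring
    rw [this, intervalIntegral.integral_comp_sub_right (fun u : ℝ => u⁻¹), integral_inv_of_pos
      (by linarith) (by linarith)]
    apply log_le_log
    · apply div_pos <;> linarith
    · rw [show 1 + θ / φ = (φ + θ) / φ by field_simp]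
      rw [show θ - (θ - φ) = φ by ring]
      gcongr; linarith
  linarith

lemma S2_meas : MeasurableSet S2 := Metric.isClosed_sphere.measurableSet

lemma ton (A B : Set ℝ) (f : ℝ × ℝ → ℝ≥0∞) (hf : Measurable f) :
    ∫⁻ p in A ×ˢ B, f p = ∫⁻ β in B, ∫⁻ α in A, f (α, β) := by
  rw [Measure.volume_eq_prod, ← Measure.prod_restrict, lintegral_prod_symm _ hf.aemeasurable]

lemma ton' (A B : Set ℝ) (f : ℝ × ℝ → ℝ≥0∞) (hf : Measurable f) :
    ∫⁻ p in A ×ˢ B, f p = ∫⁻ α in A, ∫⁻ β in B, f (α, β) := by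
  rw [Measure.volume_eq_prod, ← Measure.prod_restrict, lintegral_prod _ hf.aemeasurable]

lemma arct' (A : Set ℝ) (a t : ℝ) :
    ∫⁻ α in A, ENNReal.ofReal (|t| / ((a - α) ^ 2 + t ^ 2)) ≤ ENNReal.ofReal π :=
  (setLIntegral_le_lintegral _ _).trans (arct a t)

lemma I_N1 (A B : Set ℝ) (φ τ : ℝ) : ∫⁻ p in A ×ˢ B, ENNReal.ofReal (|φ| / ((τ - p.2) ^ 2 + φ ^ 2) *
    (|p.2 - τ| / ((φ - p.1) ^ 2 + (p.2 - τ) ^ 2))) ≤ ENNReal.ofReal (π * π) := by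
  rw [ton _ _ _ (by fun_prop)]
  calc _ ≤ ∫⁻ β in B, ENNReal.ofReal (|φ| / ((τ - β) ^ 2 + φ ^ 2)) * ENNReal.ofReal π := by
        refine lintegral_mono fun β => ?_
        simp only
        have : ∀ α : ℝ, ENNReal.ofReal (|φ| / ((τ - β) ^ 2 + φ ^ 2) *
          (|β - τ| / ((φ - α) ^ 2 + (β - τ) ^ 2))) = ENNReal.ofReal (|φ| / ((τ - β) ^ 2 + φ ^ 2)) *
          ENNReal.ofReal (|β - τ| / ((φ - α) ^ 2 + (β - τ) ^ 2)) :=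
          fun α => ENNReal.ofReal_mul (by positivity)
        simp_rw [this]
        rw [lintegral_const_mul _ (by fun_prop)]
        gcongr
        exact arct' _ _ _
    _ ≤ _ := by
        rw [lintegral_mul_const _ (by fun_prop), ENNReal.ofReal_mul pi_pos.le]
        gcongr
        exact arct' _ _ _

lemma I_c (A : Set ℝ) (a b : ℝ) (g : ℝ → ℝ) (hg : Measurable g) (x : ℝ) (_hab : a ≤ b) :
    ∫⁻ p in A ×ˢ Icc a b, ENNReal.ofReal (|g p.2| / ((x - p.1) ^ 2 + (g p.2) ^ 2)) ≤
      ENNReal.ofReal (π * (b - a)) := by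
  rw [ton _ _ _ (by fun_prop)]
  calc _ ≤ ∫⁻ β in Icc a b, ENNReal.ofReal π := lintegral_mono fun β => arct' _ _ _
    _ = _ := by
      rw [lintegral_const, Measure.restrict_apply_univ, Real.volume_Icc, ENNReal.ofReal_mul pi_pos.le]

lemma I_c' (B : Set ℝ) (a b : ℝ) (x : ℝ) (y : ℝ) (_hab : a ≤ b) :
    ∫⁻ p in Icc a b ×ˢ B, ENNReal.ofReal (|x - p.1| / ((y - p.2) ^ 2 + (x - p.1) ^ 2)) ≤
      ENNReal.ofReal (π * (b - a)) := by
  rw [ton' _ _ _ (by fun_prop)]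
  calc _ ≤ ∫⁻ β in Icc a b, ENNReal.ofReal π := lintegral_mono fun β => arct' _ _ _
    _ = _ := by
      rw [lintegral_const, Measure.restrict_apply_univ, Real.volume_Icc, ENNReal.ofReal_mul pi_pos.le]

lemma I_log {φ θ : ℝ} (hφ : 0 < φ) (hθ : 0 ≤ θ) :
    ∫⁻ p in Ioi φ ×ˢ Ioc 0 (3 * θ / 2), ENNReal.ofReal (1 / (p.1 + |p.2 - θ|) ^ 2) ≤
      ENNReal.ofReal (2 * log (1 + θ / φ)) := by
  rw [ton _ _ _ (by fun_prop)]
  refine le_trans (lintegral_mono fun β => ?_) (logint hφ hθ)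
  exact invsq (by positivity)

lemma far_aux {k : ℝ} (hk : 0 ≤ k) (A : Set ℝ) :
    ∫⁻ t in Ioi (3 * k / 2), ∫⁻ s in A, ENNReal.ofReal (k * |s| / (s ^ 2 + t ^ 2) ^ 2) ≤
      ENNReal.ofReal π := by
  rcases hk.eq_or_lt with rfl | hk
  · simp
  calc _ ≤ ∫⁻ t in Ioi (3 * k / 2), ENNReal.ofReal (1 / (t + 0) ^ 2) * ENNReal.ofReal (k / 2 * π) := by
        refine setLIntegral_mono (by fun_prop) fun t ht => ?_
        have ht : 0 < t := lt_trans (by positivity) ht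
        have h1 : ∀ s : ℝ, ENNReal.ofReal (k * |s| / (s ^ 2 + t ^ 2) ^ 2) ≤
            ENNReal.ofReal (1 / (t + 0) ^ 2 * (k / 2)) * ENNReal.ofReal (|t| / ((0 - s) ^ 2 + t ^ 2)) := by
          intro s
          rw [← ENNReal.ofReal_mul (by positivity)]
          apply ENNReal.ofReal_le_ofReal
          rw [add_zero, abs_of_pos ht, zero_sub, neg_sq]
          have : 1 / t ^ 2 * (k / 2) * (t / (s ^ 2 + t ^ 2)) = (k * (s ^ 2 + t ^ 2) / (2 * t)) / (s ^ 2 + t ^ 2) ^ 2 := by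
            field_simp
          rw [this]
          gcongr
          rw [le_div_iff₀ (by positivity)]
          have := sq_nonneg (|s| - t)
          rw [sub_sq, sq_abs] at this
          nlinarith
        refine (lintegral_mono h1).trans ?_
        rw [lintegral_const_mul _ (by fun_prop), ENNReal.ofReal_mul (by positivity), mul_assoc,
          ENNReal.ofReal_mul (by positivity : 0 ≤ k / 2)]
        gcongr
        exact arct' _ _ _
    _ ≤ _ := by
        rw [lintegral_mul_const _ (by fun_prop)]
        refine (mul_le_mul_left (invsq (by positivity)) _).trans ?_
        rw [← ENNReal.ofReal_mul (by positivity)]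
        apply ENNReal.ofReal_le_ofReal
        rw [add_zero]
        have : 1 / (3 * k / 2) * (k / 2 * π) = π / 3 := by field_simp
        rw [this]; linarith [pi_pos]

lemma I_far {φ θ : ℝ} (hφ : 0 ≤ φ) (hθ : 0 ≤ θ) :
    ∫⁻ p in Ioo (3 * φ / 2) π ×ˢ Ioo (3 * θ / 2) (π / 2),
      (ENNReal.ofReal (θ * |p.1| / (p.1 ^ 2 + p.2 ^ 2) ^ 2) +
       ENNReal.ofReal (φ * |p.2| / (p.2 ^ 2 + p.1 ^ 2) ^ 2)) ≤ ENNReal.ofReal (2 * π) := by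
  rw [lintegral_add_left (by fun_prop), two_mul, ENNReal.ofReal_add pi_pos.le pi_pos.le]
  refine add_le_add ?_ ?_
  · rw [ton _ _ _ (by fun_prop)]
    refine le_trans (lintegral_mono_set ?_) (far_aux hθ _)
    exact fun x hx => hx.1
  · rw [ton' _ _ _ (by fun_prop)]
    refine le_trans (lintegral_mono_set ?_) (far_aux hφ _)
    exact fun x hx => hx.1

/-- integrability of the singular kernel -/
lemma inv_dist_lint {φ θ : ℝ} (hφ : φ ∈ Icc (0:ℝ) 1) (hθ : θ ∈ Icc (0:ℝ) 1) :
    ∫⁻ y, ENNReal.ofReal (‖sc φ θ - y‖⁻¹) ∂sigma2 < ⊤ := by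
  have hs : sigma2 = sigma2.restrict ((fun p : ℝ × ℝ => sc p.1 p.2) '' (Icc (-π) π ×ˢ Icc (-(π / 2)) (π / 2))) := by
    rw [sigma2, Measure.restrict_restrict' S2_meas,
      inter_eq_right.2 S2_sub]
  rw [hs]
  refine (lint_le _ _ (by fun_prop)).trans_lt ?_
  refine ENNReal.mul_lt_top (by norm_num) ?_
  have hb : ∫⁻ p in Icc (-π) π ×ˢ Icc (-(π / 2)) (π / 2),
      ENNReal.ofReal 1000 * (ENNReal.ofReal (|θ - p.2| / ((φ - p.1) ^ 2 + (θ - p.2) ^ 2)) +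
       ENNReal.ofReal (|φ - p.1| / ((θ - p.2) ^ 2 + (φ - p.1) ^ 2))) < ⊤ := by
    rw [lintegral_const_mul _ (by fun_prop), lintegral_add_left (by fun_prop)]
    refine ENNReal.mul_lt_top (by simp) (ENNReal.add_lt_top.2 ⟨?_, ?_⟩)
    · exact (I_c _ _ _ (fun b => θ - b) (by fun_prop) φ (by linarith [pi_pos])).trans_lt (by simp)
    · exact (I_c' _ _ _ φ θ (by linarith [pi_pos])).trans_lt (by simp)
  refine lt_of_le_of_lt (setLIntegral_mono (by fun_prop) fun p hp => ?_) hb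
  obtain ⟨hp1, hp2⟩ := hp
  have h := dist_lb hφ hθ (abs_le.2 hp1) (abs_le.2 hp2)
  rw [← ENNReal.ofReal_add (by positivity) (by positivity), ← ENNReal.ofReal_mul (by positivity)]
  apply ENNReal.ofReal_le_ofReal
  set u := φ - p.1
  set v := θ - p.2
  set d := ‖sc φ θ - sc p.1 p.2‖
  rw [add_comm (v ^ 2), ← add_div]
  have hd : 0 ≤ d := norm_nonneg _
  rcases (by positivity : 0 ≤ u ^ 2 + v ^ 2).eq_or_lt with h0 | h0
  · have hu : u = 0 := by nlinarith
    have hv : v = 0 := by nlinarith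
    have : d = 0 := by
      have : sc φ θ = sc p.1 p.2 := by
        congr 1
        · linarith
        · linarith
      simp [d, this]
    rw [this, hu, hv]; simp
  · have hdp : 0 < d := by
      by_contra hc
      have : d = 0 := by linarith
      rw [this] at h
      nlinarith
    rw [inv_eq_one_div, mul_div_assoc', div_le_div_iff₀ hdp h0]
    have hm : d * (|v| + |u|) * 1000 ≥ (u ^ 2 + v ^ 2) := by
      have hs : u ^ 2 + v ^ 2 ≤ (|v| + |u|) ^ 2 := by
        rw [← sq_abs u, ← sq_abs v]; nlinarith [abs_nonneg u, abs_nonneg v]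
      apply le_of_sq_le_sq _ (by positivity)
      nlinarith
    linarith

@[fun_prop]
lemma vec3_meas {X : Type*} [MeasurableSpace X] {f g h : X → ℝ} (hf : Measurable f) (hg : Measurable g)
    (hh : Measurable h) : Measurable (fun y => vec3 (f y) (g y) (h y)) := by
  refine (WithLp.measurable_toLp 2 _).comp (measurable_pi_iff.2 fun i => ?_)
  fin_cases i
  · exact hf
  · exact hg
  · exact hh

@[fun_prop] lemma flip2_meas : Measurable flip2 := by unfold flip2; fun_prop
@[fun_prop] lemma flip3_meas : Measurable flip3 := by unfold flip3; fun_prop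

lemma flip2_inv (y : E3) : flip2 (flip2 y) = y := by apply E3_ext <;> simp [flip2]
lemma flip3_inv (y : E3) : flip3 (flip3 y) = y := by apply E3_ext <;> simp [flip3]
lemma flip_comm (y : E3) : flip2 (flip3 y) = flip3 (flip2 y) := by
  apply E3_ext <;> simp [flip2, flip3]

lemma flip2_iso : Isometry flip2 := by
  apply Isometry.of_dist_eq
  intro x y
  rw [dist_eq_norm, dist_eq_norm]
  have : ‖flip2 x - flip2 y‖ ^ 2 = ‖x - y‖ ^ 2 := by
    rw [nsq_sub, nsq_sub]; simp only [flip2, vec3_0, vec3_1, vec3_2]; ring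
  exact (pow_left_inj₀ (norm_nonneg _) (norm_nonneg _) (by norm_num)).1 this

lemma flip3_iso : Isometry flip3 := by
  apply Isometry.of_dist_eq
  intro x y
  rw [dist_eq_norm, dist_eq_norm]
  have : ‖flip3 x - flip3 y‖ ^ 2 = ‖x - y‖ ^ 2 := by
    rw [nsq_sub, nsq_sub]; simp only [flip3, vec3_0, vec3_1, vec3_2]; ring
  exact (pow_left_inj₀ (norm_nonneg _) (norm_nonneg _) (by norm_num)).1 this

lemma flip2_S2 {y : E3} : flip2 y ∈ S2 ↔ y ∈ S2 := by
  rw [mem_S2, mem_S2]; simp [flip2]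
lemma flip3_S2 {y : E3} : flip3 y ∈ S2 ↔ y ∈ S2 := by
  rw [mem_S2, mem_S2]; simp [flip3]

lemma mp_of (R : E3 → E3) (hi : Isometry R) (hinv : ∀ y, R (R y) = y) (hS : ∀ y, R y ∈ S2 ↔ y ∈ S2) :
    MeasurePreserving R sigma2 sigma2 := by
  let e : E3 ≃ᵢ E3 := ⟨Function.Involutive.toPerm R hinv, hi⟩
  have h : MeasurePreserving R (μH[2]) (μH[2]) := e.measurePreserving_hausdorffMeasure 2
  have h2 := h.restrict_preimage S2_meas
  have h3 : R ⁻¹' S2 = S2 := by ext y; exact hS y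
  rw [h3] at h2
  exact h2

lemma mp2 : MeasurePreserving flip2 sigma2 sigma2 := mp_of _ flip2_iso flip2_inv fun _ => flip2_S2
lemma mp3 : MeasurePreserving flip3 sigma2 sigma2 := mp_of _ flip3_iso flip3_inv fun _ => flip3_S2

lemma half (ν : Measure E3) (R : E3 → E3) (hR : MeasurePreserving R ν ν)
    (hinv : ∀ y, R (R y) = y) (i : Fin 3) (hRi : ∀ y, (R y) i = - y i) (F : E3 → ℝ)
    (hF : Integrable F ν) (h0 : ∀ᵐ y ∂ν, y i = 0 → F y = 0) :
    ∫ y, F y ∂ν = ∫ y in {y : E3 | 0 < y i}, (F y + F (R y)) ∂ν := by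
  have hm : MeasurableSet {y : E3 | 0 < y i} := measurableSet_lt (by fun_prop) (by fun_prop)
  have hm' : MeasurableSet {y : E3 | y i < 0} := measurableSet_lt (by fun_prop) (by fun_prop)
  have hFR : Integrable (fun y => F (R y)) ν := (hR.integrable_comp hF.1).2 hF
  rw [integral_add hF.integrableOn hFR.integrableOn, ← integral_add_compl hm hF]
  congr 1
  let e : E3 ≃ᵐ E3 := ⟨Function.Involutive.toPerm R hinv, hR.measurable, hR.measurable⟩
  have h1 := hR.setIntegral_preimage_emb e.measurableEmbedding F {y : E3 | y i < 0}
  have h2 : R ⁻¹' {y : E3 | y i < 0} = {y : E3 | 0 < y i} := by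
    ext y; simp [hRi]
  rw [h2] at h1
  rw [h1]
  have h3 : {y : E3 | 0 < y i}ᶜ = {y : E3 | y i < 0} ∪ {y : E3 | y i = 0} := by
    ext y; simp [le_iff_lt_or_eq]
  have hm0 : MeasurableSet {y : E3 | y i = 0} := measurableSet_eq_fun (by fun_prop) (by fun_prop)
  rw [h3, setIntegral_union _ hm0 hF.integrableOn hF.integrableOn]
  · rw [setIntegral_congr_ae (g := fun _ => (0:ℝ)) hm0 h0]
    simp
  · rw [Set.disjoint_left]
    intro y (h : y i < 0) (h' : y i = 0)
    linarith

def Kk (x y : E3) : ℝ := dot3 (cross3 x y) (ephi x) / ‖x - y‖ ^ 2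

def Gk (φ θ : ℝ) (y : E3) : ℝ :=
  y 1 * ((y 2 - sin θ) / (‖sc φ θ - y‖ ^ 2 * ‖sc φ θ - flip2 y‖ ^ 2) +
    (y 2 + sin θ) / (‖sc φ θ - flip3 y‖ ^ 2 * ‖sc φ θ - flip2 (flip3 y)‖ ^ 2))

@[fun_prop] lemma Gk_meas (φ θ : ℝ) : Measurable (Gk φ θ) := by
  unfold Gk; fun_prop

lemma cos_lb {θ : ℝ} (hθ : θ ∈ Icc (0:ℝ) 1) : 1/2 ≤ cos θ := by
  have := one_sub_sq_div_two_le_cos (x := θ)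
  nlinarith [hθ.1, hθ.2]

lemma sqrt_c {φ θ : ℝ} (hθ : θ ∈ Icc (0:ℝ) 1) : sqrt (1 - ((sc φ θ) 2) ^ 2) = cos θ := by
  have : 1 - ((sc φ θ) 2) ^ 2 = cos θ ^ 2 := by
    simp only [sc, vec3_2]; linarith [sin_sq_add_cos_sq θ]
  rw [this, sqrt_sq]; linarith [cos_lb hθ]

lemma pref {φ θ : ℝ} (hθ : θ ∈ Icc (0:ℝ) 1) :
    (sc φ θ) 1 / sqrt (1 - ((sc φ θ) 2) ^ 2) = sin φ := by
  rw [sqrt_c hθ]; simp only [sc, vec3_1]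
  have := cos_lb hθ
  rw [mul_div_assoc, mul_div_cancel₀]; linarith

lemma ephi_sc {φ θ : ℝ} (hθ : θ ∈ Icc (0:ℝ) 1) : ephi (sc φ θ) = vec3 (- sin φ) (cos φ) 0 := by
  have := cos_lb hθ
  have h : cos θ ≠ 0 := by linarith
  unfold ephi
  rw [sqrt_c hθ]
  apply E3_ext <;> simp [sc] <;> field_simp

lemma D_eq {φ θ : ℝ} {y : E3} (hy : y ∈ S2) : ‖sc φ θ - y‖ ^ 2 =
    2 - 2 * (cos θ * cos φ * y 0 + cos θ * sin φ * y 1 + sin θ * y 2) := by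
  rw [nsq_sub]
  have h1 := mem_S2.1 (sc_mem φ θ)
  have h2 := mem_S2.1 hy
  simp only [sc, vec3_0, vec3_1, vec3_2] at *
  linear_combination h1 + h2

lemma Kk_eq {φ θ : ℝ} (hθ : θ ∈ Icc (0:ℝ) 1) (y : E3) : Kk (sc φ θ) y =
    (- (y 2 * cos θ) + sin θ * (sin φ * y 1 + cos φ * y 0)) / ‖sc φ θ - y‖ ^ 2 := by
  unfold Kk
  rw [ephi_sc hθ]
  congr 1
  simp only [dot3, cross3, sc, vec3_0, vec3_1, vec3_2]
  linear_combination (- y 2 * cos θ) * (sin_sq_add_cos_sq φ)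

lemma Kk_sub {φ θ : ℝ} (hθ : θ ∈ Icc (0:ℝ) 1) {y : E3} (hy : y ∈ S2)
    (h1 : ‖sc φ θ - y‖ ^ 2 ≠ 0) (h2 : ‖sc φ θ - flip2 y‖ ^ 2 ≠ 0) :
    Kk (sc φ θ) y - Kk (sc φ θ) (flip2 y) =
      - (4 * sin φ) * (y 1 * ((y 2 - sin θ) / (‖sc φ θ - y‖ ^ 2 * ‖sc φ θ - flip2 y‖ ^ 2))) := by
  rw [Kk_eq hθ, Kk_eq hθ, div_sub_div _ _ h1 h2, mul_div_assoc', mul_div_assoc']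
  congr 1
  rw [D_eq hy, D_eq (flip2_S2.2 hy)]
  simp only [flip2, vec3_0, vec3_1, vec3_2]
  linear_combination (-4 * sin φ * y 1 * y 2) * (sin_sq_add_cos_sq θ)

lemma cross_le {x y : E3} (hx : x ∈ S2) (hy : y ∈ S2) : ‖cross3 x y‖ ≤ ‖x - y‖ := by
  apply le_of_sq_le_sq _ (norm_nonneg _)
  rw [nsq_sub, nsq]
  rw [mem_S2] at hx hy
  simp only [cross3, vec3_0, vec3_1, vec3_2]
  have := sq_nonneg (1 - (x 0 * y 0 + x 1 * y 1 + x 2 * y 2))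
  have e : (x 1 * y 2 - x 2 * y 1) ^ 2 + (x 2 * y 0 - x 0 * y 2) ^ 2 + (x 0 * y 1 - x 1 * y 0) ^ 2
    = (x 0 ^ 2 + x 1 ^ 2 + x 2 ^ 2) * (y 0 ^ 2 + y 1 ^ 2 + y 2 ^ 2) -
      (x 0 * y 0 + x 1 * y 1 + x 2 * y 2) ^ 2 := by ring
  rw [e, hx, hy]
  nlinarith

lemma dot3_inner (v e : E3) : dot3 v e = inner ℝ e v := by
  rw [PiLp.inner_apply, Fin.sum_univ_three]
  simp [dot3]

lemma bs_int {φ θ : ℝ} (hφ : φ ∈ Icc (0:ℝ) 1) (hθ : θ ∈ Icc (0:ℝ) 1) {ω : E3 → ℝ} {W : ℝ}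
    (hω : Measurable ω) (hW : ∀ y, |ω y| ≤ W) :
    Integrable (fun y => (‖sc φ θ - y‖ ^ 2)⁻¹ • ω y • cross3 (sc φ θ) y) sigma2 := by
  have hg : Integrable (fun y => ‖sc φ θ - y‖⁻¹) sigma2 := by
    refine ⟨by fun_prop, ?_⟩
    rw [hasFiniteIntegral_iff_ofReal (ae_of_all _ fun y => by positivity)]
    exact inv_dist_lint hφ hθ
  refine (hg.const_mul W).mono' ?_ ?_
  · have : Measurable (cross3 (sc φ θ)) := by unfold cross3; fun_prop
    exact (by fun_prop : Measurable _).aestronglyMeasurable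
  · filter_upwards [ae_restrict_mem S2_meas] with y hy
    rw [norm_smul, norm_smul, norm_inv, norm_pow, norm_norm, Real.norm_eq_abs]
    have h1 := cross_le (sc_mem φ θ) hy
    have h2 := hW y
    set d := ‖sc φ θ - y‖
    have hd : 0 ≤ d := norm_nonneg _
    have hW0 : 0 ≤ W := (abs_nonneg _).trans h2
    calc (d ^ 2)⁻¹ * (|ω y| * ‖cross3 (sc φ θ) y‖) ≤ (d ^ 2)⁻¹ * (W * d) := by gcongr
      _ = W * d⁻¹ := by
        rcases eq_or_ne d 0 with h | h
        · simp [h]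
        · field_simp

lemma S2q_meas : MeasurableSet S2q := by
  have h1 : MeasurableSet {y : E3 | 0 < y 1} := measurableSet_lt (by fun_prop) (by fun_prop)
  have h2 : MeasurableSet {y : E3 | 0 < y 2} := measurableSet_lt (by fun_prop) (by fun_prop)
  exact S2_meas.inter (h1.inter h2)

lemma symm_main {φ θ : ℝ} (hφ : φ ∈ Icc (0:ℝ) 1) (hθ : θ ∈ Icc (0:ℝ) 1) {ω : E3 → ℝ} {W : ℝ}
    (hω : Measurable ω) (hW : ∀ y, |ω y| ≤ W) (hodd : OddOdd ω) :
    IntegrableOn (fun y => - (4 * sin φ) * (ω y * Gk φ θ y)) S2q sigma2 ∧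
    dot3 (biotSavart ω (sc φ θ)) (ephi (sc φ θ)) =
      (2 * π)⁻¹ * ∫ y in S2q, - (4 * sin φ) * (ω y * Gk φ θ y) ∂sigma2 := by
  set x := sc φ θ with hx
  have hbs := bs_int hφ hθ hω hW
  rw [← hx] at hbs
  set F : E3 → ℝ := fun y => ω y * Kk x y with hF
  have hFe : ∀ y, inner ℝ (ephi x) ((‖x - y‖ ^ 2)⁻¹ • ω y • cross3 x y) = F y := by
    intro y
    rw [inner_smul_right, inner_smul_right, ← dot3_inner]
    simp only [hF, Kk]; ring
  have hFi : Integrable F sigma2 := by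
    have := hbs.const_inner (𝕜 := ℝ) (ephi x)
    simpa only [hFe] using this
  have hd : dot3 (biotSavart ω x) (ephi x) = (2 * π)⁻¹ * ∫ y, F y ∂sigma2 := by
    rw [dot3_inner, biotSavart, inner_smul_right, ← integral_inner hbs]
    simp only [hFe]
  -- zero sets
  have z2 : ∀ y ∈ S2, y 1 = 0 → ω y = 0 := by
    intro y hy h
    have h1 := (hodd y hy).1
    have : flip2 y = y := by apply E3_ext <;> simp [flip2, h]
    rw [this] at h1; linarith
  have z3 : ∀ y ∈ S2, y 2 = 0 → ω y = 0 := by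
    intro y hy h
    have h1 := (hodd y hy).2
    have : flip3 y = y := by apply E3_ext <;> simp [flip3, h]
    rw [this] at h1; linarith
  have hae : ∀ᵐ y ∂sigma2, y ∈ S2 := ae_restrict_mem S2_meas
  have e1 := half sigma2 flip2 mp2 flip2_inv 1 (fun y => by simp [flip2]) F hFi (by
    filter_upwards [hae] with y hy h
    simp [hF, z2 y hy h])
  have hF2 : Integrable (fun y => F (flip2 y)) sigma2 := (mp2.integrable_comp hFi.1).2 hFi
  have hm1 : MeasurableSet {y : E3 | 0 < y 1} := measurableSet_lt (by fun_prop) (by fun_prop)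
  have hm2 : MeasurableSet {y : E3 | 0 < y 2} := measurableSet_lt (by fun_prop) (by fun_prop)
  have mp3' : MeasurePreserving flip3 (sigma2.restrict {y : E3 | 0 < y 1})
      (sigma2.restrict {y : E3 | 0 < y 1}) := by
    have := mp3.restrict_preimage hm1
    have h : flip3 ⁻¹' {y : E3 | 0 < y 1} = {y : E3 | 0 < y 1} := by ext y; simp [flip3]
    rwa [h] at this
  have e2 := half (sigma2.restrict {y : E3 | 0 < y 1}) flip3 mp3' flip3_inv 2
    (fun y => by simp [flip3]) (fun y => F y + F (flip2 y)) (hFi.add hF2).restrict (by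
    filter_upwards [ae_restrict_of_ae hae] with y hy h
    have h2 : ω (flip2 y) = 0 := z3 _ (flip2_S2.2 hy) (by simpa [flip2] using h)
    simp [hF, z3 y hy h, h2])
  rw [e2] at e1
  have hmeas : (sigma2.restrict {y : E3 | 0 < y 1}).restrict {y : E3 | 0 < y 2} = sigma2.restrict S2q := by
    rw [Measure.restrict_restrict hm2]
    simp only [sigma2]
    rw [Measure.restrict_restrict (hm2.inter hm1), Measure.restrict_restrict S2q_meas]
    congr 1
    ext y; simp only [S2q, mem_inter_iff, mem_ofPred_eq]; tauto
  rw [hmeas] at e1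
  have hsum : Integrable (fun y => F y + F (flip2 y) + (F (flip3 y) + F (flip2 (flip3 y)))) sigma2 :=
    (hFi.add hF2).add ((mp3.integrable_comp (hFi.add hF2).1).2 (hFi.add hF2))
  have hna : ∀ᵐ y ∂sigma2, y ≠ x := by
    have := Measure.nullSingletonClass_hausdorff E3 (d := 2) (by norm_num)
    refine ae_restrict_of_ae ?_
    rw [ae_iff]
    simp
  have hx1 : 0 ≤ cos θ * sin φ := mul_nonneg (by linarith [cos_lb hθ])
    (sin_nonneg_of_nonneg_of_le_pi hφ.1 (by linarith [hφ.2, pi_gt_three]))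
  have hx2 : 0 ≤ sin θ := sin_nonneg_of_nonneg_of_le_pi hθ.1 (by linarith [hθ.2, pi_gt_three])
  have key : ∀ᵐ y ∂(sigma2.restrict S2q), F y + F (flip2 y) + (F (flip3 y) + F (flip2 (flip3 y)))
      = - (4 * sin φ) * (ω y * Gk φ θ y) := by
    filter_upwards [ae_restrict_of_ae hna, ae_restrict_mem S2q_meas] with y hne ⟨hy, hy1, hy2⟩
    have w2 := (hodd y hy).1
    have w3 := (hodd y hy).2
    have w23 := (hodd _ (flip3_S2.2 hy)).1
    have d0 : 0 < ‖x - y‖ ^ 2 := by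
      have : 0 < ‖x - y‖ := norm_pos_iff.2 (sub_ne_zero.2 hne.symm)
      positivity
    have m1 := mul_nonneg hx1 hy1.le
    have m2 := mul_nonneg hx2 hy2.le
    have D0 := D_eq (φ := φ) (θ := θ) hy
    have D2 := D_eq (φ := φ) (θ := θ) (flip2_S2.2 hy)
    have D3 := D_eq (φ := φ) (θ := θ) (flip3_S2.2 hy)
    have D23 := D_eq (φ := φ) (θ := θ) (flip2_S2.2 (flip3_S2.2 hy))
    rw [← hx] at D0 D2 D3 D23
    simp only [flip2, flip3, vec3_0, vec3_1, vec3_2] at D2 D3 D23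
    have d2 : 0 < ‖x - flip2 y‖ ^ 2 := by
      simp only [flip2]; linarith
    have d3 : 0 < ‖x - flip3 y‖ ^ 2 := by
      simp only [flip3]; linarith
    have d23 : 0 < ‖x - flip2 (flip3 y)‖ ^ 2 := by
      simp only [flip2, flip3, vec3_0, vec3_1, vec3_2]; linarith
    have k1 := Kk_sub hθ hy d0.ne' d2.ne'
    have k2 := Kk_sub hθ (flip3_S2.2 hy) d3.ne' d23.ne'
    rw [← hx] at k1 k2
    have f1 : (flip3 y) 1 = y 1 := rfl
    have f2 : (flip3 y) 2 = - y 2 := rfl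
    rw [f1, f2] at k2
    simp only [hF, Gk]
    rw [w23, w3, w2, ← hx]
    have : (-y 2 - sin θ) / (‖x - flip3 y‖ ^ 2 * ‖x - flip2 (flip3 y)‖ ^ 2) =
      - ((y 2 + sin θ) / (‖x - flip3 y‖ ^ 2 * ‖x - flip2 (flip3 y)‖ ^ 2)) := by ring
    rw [this] at k2
    linear_combination ω y * k1 - ω y * k2
  refine ⟨(hsum.restrict).congr key, ?_⟩
  rw [hd, e1, integral_congr_ae key]

def hk (φ α t : ℝ) : ℝ := α * |t| / (((φ - α) ^ 2 + t ^ 2) * ((φ + α) ^ 2 + t ^ 2))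

lemma quot_bd {N n A B a b : ℝ} (hN : |N| ≤ n) (ha : 0 ≤ a) (hb : 0 < b)
    (hA : (1 / 100000) * a ≤ A) (hB : (1 / 100000) * b ≤ B) (h0 : a = 0 → n = 0) :
    |N / (A * B)| ≤ 10000000000 * (n / (a * b)) := by
  rcases ha.eq_or_lt with h | h
  · have hn := h0 h.symm
    rw [hn] at hN
    have : N = 0 := abs_nonpos_iff.1 hN
    rw [this, hn]; simp
  · have hA' : 0 < A := by linarith
    have hB' : 0 < B := by linarith
    rw [abs_div, abs_of_pos (mul_pos hA' hB')]
    have hn : 0 ≤ n := (abs_nonneg _).trans hN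
    have : 10000000000 * (n / (a * b)) = n / ((1 / 100000) * a * ((1 / 100000) * b)) := by
      field_simp; norm_num; ring
    rw [this]
    gcongr

lemma G_bd {φ θ α β : ℝ} (hφ : φ ∈ Icc (0:ℝ) 1) (hθ : θ ∈ Icc (0:ℝ) 1)
    (hα : α ∈ Ioo 0 π) (hβ : β ∈ Ioo 0 (π / 2)) :
    |Gk φ θ (sc α β)| ≤ 10000000000 * (hk φ α (β - θ) + hk φ α (β + θ)) := by
  obtain ⟨ha, ha'⟩ := hα
  obtain ⟨hb, hb'⟩ := hβ
  have hab1 : |α| ≤ π := by rw [abs_of_pos ha]; exact ha'.le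
  have hab2 : |β| ≤ π / 2 := by rw [abs_of_pos hb]; exact hb'.le
  have d1 := dist_lb hφ hθ hab1 hab2
  have d2 := dist_lb hφ hθ (α := -α) (by rwa [abs_neg]) hab2
  have d3 := dist_lb hφ hθ (β := -β) hab1 (by rwa [abs_neg])
  have d4 := dist_lb hφ hθ (α := -α) (β := -β) (by rwa [abs_neg]) (by rwa [abs_neg])
  unfold Gk
  rw [flip3_sc, flip2_sc, flip2_sc]
  have y1 : 0 ≤ (sc α β) 1 := by
    simp only [sc, vec3_1]
    exact mul_nonneg (cos_nonneg_of_mem_Icc ⟨by linarith, hb'.le⟩) (sin_nonneg_of_nonneg_of_le_pi ha.le ha'.le)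
  have y1' : (sc α β) 1 ≤ α := by
    simp only [sc, vec3_1]
    have := sin_nonneg_of_nonneg_of_le_pi ha.le ha'.le
    have := sin_le ha.le
    have := cos_le_one β
    nlinarith
  have lip : ∀ u v : ℝ, |sin u - sin v| ≤ |u - v| := by
    intro u v
    have := Real.abs_sin_sub_sin_le u v
    exact this
  have n1 : |(sc α β) 2 - sin θ| ≤ |β - θ| := lip β θ
  have n2 : |(sc α β) 2 + sin θ| ≤ |β + θ| := by
    have := lip β (-θ)
    rw [sin_neg, sub_neg_eq_add, sub_neg_eq_add] at this
    exact this
  have q1 := quot_bd (b := (φ - -α) ^ 2 + (θ - β) ^ 2) n1 (by positivity)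
    (by have : 0 < φ - -α := by linarith [hφ.1]
        positivity) d1 d2 (by
      intro h
      have : β - θ = 0 := by nlinarith [sq_nonneg (φ - α), sq_nonneg (θ - β)]
      simp [this])
  have q2 := quot_bd (b := (φ - -α) ^ 2 + (θ - -β) ^ 2) n2 (by positivity)
    (by have : 0 < φ - -α := by linarith [hφ.1]
        positivity) d3 d4 (by
      intro h
      have : β + θ = 0 := by nlinarith [sq_nonneg (φ - α), sq_nonneg (θ - -β)]
      simp [this])
  rw [abs_mul, abs_of_nonneg y1]
  have e1 : α * (|β - θ| / (((φ - α) ^ 2 + (θ - β) ^ 2) * ((φ - -α) ^ 2 + (θ - β) ^ 2))) = hk φ α (β - θ) := by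
    unfold hk; rw [mul_div_assoc]; congr 3 <;> ring
  have e2 : α * (|β + θ| / (((φ - α) ^ 2 + (θ - -β) ^ 2) * ((φ - -α) ^ 2 + (θ - -β) ^ 2))) = hk φ α (β + θ) := by
    unfold hk; rw [mul_div_assoc]; congr 3 <;> ring
  rw [← e1, ← e2]
  refine (mul_le_mul y1' ((abs_add_le _ _).trans (add_le_add q1 q2)) (abs_nonneg _) ha.le).trans ?_
  apply le_of_eq; ring

lemma hk_N1 {φ α t : ℝ} (ha : 0 < α) (h : α ≤ 3 * φ / 2) :
    hk φ α t ≤ 3 / 2 * (|φ| / (t ^ 2 + φ ^ 2) * (|t| / ((φ - α) ^ 2 + t ^ 2))) := by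
  have hφ : 0 < φ := by linarith
  rw [abs_of_pos hφ]
  have e : hk φ α t = α / ((φ + α) ^ 2 + t ^ 2) * (|t| / ((φ - α) ^ 2 + t ^ 2)) := by
    unfold hk; rw [div_mul_div_comm, mul_comm ((φ + α) ^ 2 + t ^ 2)]
  rw [e, ← mul_assoc]
  gcongr
  rw [mul_div_assoc']
  have : (φ + α) ^ 2 + t ^ 2 ≥ t ^ 2 + φ ^ 2 := by nlinarith
  gcongr
  linarith

lemma hk_N2 {φ α t : ℝ} (hφ : 0 ≤ φ) (h : 3 * φ / 2 < α) :
    hk φ α t ≤ 9 * (α * |t| / (α ^ 2 + t ^ 2) ^ 2) := by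
  have ha : 0 < α := by linarith
  have e : 9 * (α * |t| / (α ^ 2 + t ^ 2) ^ 2) = α * |t| / ((1 / 9 * (α ^ 2 + t ^ 2)) * (α ^ 2 + t ^ 2)) := by
    field_simp
  rw [e]; unfold hk
  have h1 : 1 / 9 * (α ^ 2 + t ^ 2) ≤ (φ - α) ^ 2 + t ^ 2 := by nlinarith
  have h2 : α ^ 2 + t ^ 2 ≤ (φ + α) ^ 2 + t ^ 2 := by nlinarith
  gcongr

lemma hk_half {φ α t : ℝ} (hφ : 0 ≤ φ) (h : 3 * φ / 2 < α) :
    hk φ α t ≤ 9 / 2 * (1 / (α ^ 2 + t ^ 2)) := by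
  have ha : 0 < α := by linarith
  refine (hk_N2 hφ h).trans ?_
  have e : 9 / 2 * (1 / (α ^ 2 + t ^ 2)) = 9 * (((α ^ 2 + t ^ 2) / 2) / (α ^ 2 + t ^ 2) ^ 2) := by
    field_simp
  rw [e]
  gcongr
  nlinarith [sq_nonneg (α - |t|), sq_abs t]

lemma hk_log {φ α t : ℝ} (hφ : 0 ≤ φ) (h : 3 * φ / 2 < α) :
    hk φ α t ≤ 9 * (1 / (α + |t|) ^ 2) := by
  have ha : 0 < α := by linarith
  refine (hk_half hφ h).trans ?_
  have e : 9 / 2 * (1 / (α ^ 2 + t ^ 2)) = 9 * (1 / (2 * (α ^ 2 + t ^ 2))) := by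
    field_simp
  rw [e]
  gcongr
  nlinarith [sq_nonneg (α - |t|), sq_abs t]

lemma hk_far {φ α t θ : ℝ} (hφ : 0 ≤ φ) (hθ : 0 < θ) (h : 3 * φ / 2 < α)
    (h2 : θ ≤ |t| ∨ θ ≤ α) :
    hk φ α t ≤ 9 / θ * (|θ| / ((0 - α) ^ 2 + θ ^ 2)) := by
  have ha : 0 < α := by linarith
  refine (hk_half hφ h).trans ?_
  rw [abs_of_pos hθ]
  have e : 9 / θ * (θ / ((0 - α) ^ 2 + θ ^ 2)) = 9 / 2 * (1 / ((α ^ 2 + θ ^ 2) / 2)) := by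
    rw [zero_sub, neg_sq]; field_simp
  rw [e]
  have : (α ^ 2 + θ ^ 2) / 2 ≤ α ^ 2 + t ^ 2 := by
    rw [← sq_abs t]
    rcases h2 with h2 | h2 <;> nlinarith [sq_nonneg |t|]
  gcongr

lemma hk_lip {φ α t : ℝ} (hφ : 0 ≤ φ) (h : 3 * φ / 2 < α) :
    α * hk φ α t ≤ 9 * (|t| / ((0 - α) ^ 2 + t ^ 2)) := by
  have ha : 0 < α := by linarith
  refine (mul_le_mul_of_nonneg_left (hk_N2 hφ h) ha.le).trans ?_
  rw [zero_sub, neg_sq]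
  have e : 9 * (|t| / (α ^ 2 + t ^ 2)) = 9 * (((α ^ 2 + t ^ 2) * |t|) / (α ^ 2 + t ^ 2) ^ 2) := by
    field_simp
  rw [e]
  have e2 : α * (9 * (α * |t| / (α ^ 2 + t ^ 2) ^ 2)) = 9 * (α ^ 2 * |t| / (α ^ 2 + t ^ 2) ^ 2) := by ring
  rw [e2]
  gcongr
  nlinarith [sq_nonneg t]

lemma D_diff {φ θ : ℝ} (hφ : φ ∈ Icc (0:ℝ) 1) (hθ : θ ∈ Icc (0:ℝ) 1) (α β : ℝ) :
    |‖sc φ θ - sc α β‖ ^ 2 - (2 - 2 * (cos β * cos α))| ≤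
      φ ^ 2 + θ ^ 2 + 2 * (φ * |α|) + 2 * (θ * |β|) := by
  rw [D_eq (sc_mem α β)]
  simp only [sc, vec3_0, vec3_1, vec3_2]
  have e : 2 - 2 * (cos θ * cos φ * (cos β * cos α) + cos θ * sin φ * (cos β * sin α) + sin θ * sin β) -
    (2 - 2 * (cos β * cos α)) = 2 * ((1 - cos θ * cos φ) * (cos β * cos α)) + -(2 * ((cos θ * cos β) * (sin φ * sin α)))
      + -(2 * (sin θ * sin β)) := by ring
  rw [e]
  have sα : |sin α| ≤ |α| := abs_sin_le_abs
  have sβ : |sin β| ≤ |β| := abs_sin_le_abs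
  have sφ : |sin φ| ≤ φ := by have := abs_sin_le_abs (x := φ); rwa [abs_of_nonneg hφ.1] at this
  have sθ : |sin θ| ≤ θ := by have := abs_sin_le_abs (x := θ); rwa [abs_of_nonneg hθ.1] at this
  have c : ∀ u v : ℝ, |cos u * cos v| ≤ 1 := by
    intro u v
    rw [abs_mul]
    exact mul_le_one₀ (abs_cos_le_one u) (abs_nonneg _) (abs_cos_le_one v)
  have t1 : |1 - cos θ * cos φ| ≤ (φ ^ 2 + θ ^ 2) / 2 := by
    rw [abs_of_nonneg (by linarith [(abs_le.1 (c θ φ)).2])]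
    have a1 := one_sub_sq_div_two_le_cos (x := θ)
    have a2 := one_sub_sq_div_two_le_cos (x := φ)
    have a3 := cos_le_one θ
    have a4 := cos_le_one φ
    nlinarith [cos_lb hθ, cos_lb hφ]
  have b1 : |(1 - cos θ * cos φ) * (cos β * cos α)| ≤ (φ ^ 2 + θ ^ 2) / 2 * 1 := by
    rw [abs_mul]; exact mul_le_mul t1 (c _ _) (abs_nonneg _) (by positivity)
  have b2 : |(cos θ * cos β) * (sin φ * sin α)| ≤ 1 * (φ * |α|) := by
    rw [abs_mul, abs_mul (sin φ)]
    exact mul_le_mul (c _ _) (mul_le_mul sφ sα (abs_nonneg _) hφ.1) (by positivity) (by norm_num)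
  have b3 : |sin θ * sin β| ≤ θ * |β| := by
    rw [abs_mul]; exact mul_le_mul sθ sβ (abs_nonneg _) hθ.1
  refine (abs_add_three _ _ _).trans ?_
  rw [abs_neg, abs_neg, abs_mul 2, abs_mul 2, abs_mul 2, abs_of_pos (by norm_num : (0:ℝ) < 2)]
  linarith

lemma inv_diff {Z A B e m : ℝ} (hm : 0 < m) (hZ : m ≤ Z) (hA : m ≤ A) (hB : m ≤ B)
    (h1 : |A - Z| ≤ e) (h2 : |B - Z| ≤ e) : |1 / Z ^ 2 - 1 / (A * B)| ≤ 2 * e / m ^ 3 := by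
  have hZ' : 0 < Z := by linarith
  have hA' : 0 < A := by linarith
  have hB' : 0 < B := by linarith
  have he : 0 ≤ e := (abs_nonneg _).trans h1
  have : 1 / Z ^ 2 - 1 / (A * B) = (A - Z) / (Z * Z * A) + (B - Z) / (Z * A * B) := by
    field_simp; ring
  rw [this]
  refine (abs_add_le _ _).trans ?_
  rw [abs_div, abs_div, abs_of_pos (by positivity : 0 < Z * Z * A), abs_of_pos (by positivity : 0 < Z * A * B)]
  have q1 : |A - Z| / (Z * Z * A) ≤ e / (m * m * m) := by gcongr
  have q2 : |B - Z| / (Z * A * B) ≤ e / (m * m * m) := by gcongr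
  refine (add_le_add q1 q2).trans (le_of_eq ?_)
  ring

def Pk (y : E3) : ℝ := y 1 * y 2 / ‖y - x₀‖ ^ 4

@[fun_prop] lemma Pk_meas : Measurable Pk := by unfold Pk; fun_prop

def KF : ℝ := 14 * 900000 ^ 3

lemma third_sq {φ α : ℝ} (h0 : 0 ≤ φ) (h : 3 * φ / 2 < α) : α ^ 2 / 9 ≤ (φ - α) ^ 2 ∧ α ^ 2 / 9 ≤ (φ - -α) ^ 2 := by
  have h1 : α / 3 ≤ α - φ := by linarith
  have h2 : α / 3 ≤ α + φ := by linarith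
  have h3 : 0 ≤ α / 3 := by linarith
  have e1 := pow_le_pow_left₀ h3 h1 2
  have e2 := pow_le_pow_left₀ h3 h2 2
  constructor
  · linarith [show (φ - α) ^ 2 = (α - φ) ^ 2 by ring, show α ^ 2 / 9 = (α / 3) ^ 2 by ring]
  · linarith [show (φ - -α) ^ 2 = (α + φ) ^ 2 by ring, show α ^ 2 / 9 = (α / 3) ^ 2 by ring]

lemma e_bd {φ θ α β : ℝ} (hφ0 : 0 ≤ φ) (hθ0 : 0 ≤ θ) (ha0 : 3 * φ / 2 < α) (hb0 : 3 * θ / 2 < β) :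
    φ ^ 2 + θ ^ 2 + 2 * (φ * α) + 2 * (θ * β) ≤ 3 * (φ * α + θ * β) := by
  have h1 : φ * φ ≤ φ * α := mul_le_mul_of_nonneg_left (by linarith) hφ0
  have h2 : θ * θ ≤ θ * β := mul_le_mul_of_nonneg_left (by linarith) hθ0
  rw [sq, sq]; linarith

lemma far_real {φ θ α β s Z A B A' B' Y1 Y2 : ℝ} (hφ0 : 0 ≤ φ) (hθ0 : 0 ≤ θ) (ha0 : 3 * φ / 2 < α) (hb0 : 3 * θ / 2 < β)
    (ha : 0 < α) (hb : 0 < β) (hs : 0 ≤ s) (hs' : s ≤ θ)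
    (y1 : 0 ≤ Y1) (y1' : Y1 ≤ α) (y2 : 0 ≤ Y2) (y2' : Y2 ≤ β)
    (mZ : (α ^ 2 + β ^ 2) / 900000 ≤ Z) (mA : (α ^ 2 + β ^ 2) / 900000 ≤ A) (mB : (α ^ 2 + β ^ 2) / 900000 ≤ B)
    (mA' : (α ^ 2 + β ^ 2) / 900000 ≤ A') (mB' : (α ^ 2 + β ^ 2) / 900000 ≤ B')
    (f1 : |A - Z| ≤ φ ^ 2 + θ ^ 2 + 2 * (φ * α) + 2 * (θ * β)) (f2 : |B - Z| ≤ φ ^ 2 + θ ^ 2 + 2 * (φ * α) + 2 * (θ * β))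
    (f3 : |A' - Z| ≤ φ ^ 2 + θ ^ 2 + 2 * (φ * α) + 2 * (θ * β)) (f4 : |B' - Z| ≤ φ ^ 2 + θ ^ 2 + 2 * (φ * α) + 2 * (θ * β)) :
    |2 * (Y1 * Y2 / Z ^ 2) - Y1 * ((Y2 - s) / (A * B) + (Y2 + s) / (A' * B'))| ≤
      KF * (θ * |α| / (α ^ 2 + β ^ 2) ^ 2 + φ * |β| / (β ^ 2 + α ^ 2) ^ 2) := by
  have hr : 0 < α ^ 2 + β ^ 2 := by positivity
  have he' := e_bd hφ0 hθ0 ha0 hb0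
  have he0 : 0 ≤ φ ^ 2 + θ ^ 2 + 2 * (φ * α) + 2 * (θ * β) := by positivity
  generalize φ ^ 2 + θ ^ 2 + 2 * (φ * α) + 2 * (θ * β) = e at *
  have hrdef : ∃ r, r = α ^ 2 + β ^ 2 := ⟨_, rfl⟩
  obtain ⟨r, hrdef⟩ := hrdef
  rw [add_comm (β ^ 2)]
  rw [← hrdef] at hr mZ mA mB mA' mB' ⊢
  have hmd : ∃ m, m = r / 900000 := ⟨_, rfl⟩
  obtain ⟨m, hm⟩ := hmd
  rw [← hm] at mZ mA mB mA' mB'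
  have hm0 : 0 < m := by rw [hm]; positivity
  have hA0 : 0 < A := by linarith
  have hB0 : 0 < B := by linarith
  have hA0' : 0 < A' := by linarith
  have hB0' : 0 < B' := by linarith
  have i1 := inv_diff hm0 mZ mA mB f1 f2
  have i2 := inv_diff hm0 mZ mA' mB' f3 f4
  have j1 : |1 / (A * B)| ≤ 1 / (m * m) := by
    rw [abs_of_nonneg (by positivity)]; gcongr
  have j2 : |1 / (A' * B')| ≤ 1 / (m * m) := by
    rw [abs_of_nonneg (by positivity)]; gcongr
  have eq : 2 * (Y1 * Y2 / Z ^ 2) - Y1 * ((Y2 - s) / (A * B) + (Y2 + s) / (A' * B')) =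
      (Y1 * Y2) * ((1 / Z ^ 2 - 1 / (A * B)) + (1 / Z ^ 2 - 1 / (A' * B'))) +
      (Y1 * s) * (1 / (A * B) - 1 / (A' * B')) := by ring
  rw [eq]
  have k1 : |(Y1 * Y2) * ((1 / Z ^ 2 - 1 / (A * B)) + (1 / Z ^ 2 - 1 / (A' * B')))| ≤
      (α * β) * (2 * e / m ^ 3 + 2 * e / m ^ 3) := by
    rw [abs_mul, abs_of_nonneg (by positivity : 0 ≤ Y1 * Y2)]
    gcongr
    exact (abs_add_le _ _).trans (add_le_add i1 i2)
  have k2 : |(Y1 * s) * (1 / (A * B) - 1 / (A' * B'))| ≤ (α * θ) * (1 / (m * m) + 1 / (m * m)) := by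
    rw [abs_mul, abs_of_nonneg (by positivity : 0 ≤ Y1 * s)]
    gcongr
    exact (abs_sub _ _).trans (add_le_add j1 j2)
  refine (abs_add_le _ _).trans ((add_le_add k1 k2).trans ?_)
  rw [abs_of_pos ha, abs_of_pos hb]
  have g1 : (α * β) * (2 * e / m ^ 3 + 2 * e / m ^ 3) ≤ 12 * 900000 ^ 3 * ((θ * α + φ * β) / r ^ 2) := by
    have h1 : (α * β) * (2 * e / m ^ 3 + 2 * e / m ^ 3) = 4 * 900000 ^ 3 * ((α * β * e / r) / r ^ 2) := by
      rw [hm]; field_simp; ring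
    have h2 : 12 * 900000 ^ 3 * ((θ * α + φ * β) / r ^ 2) = 4 * 900000 ^ 3 * ((3 * (θ * α + φ * β)) / r ^ 2) := by ring
    rw [h1, h2]
    gcongr
    rw [div_le_iff₀ hr]
    have s1 : α * β * e ≤ α * β * (3 * (φ * α + θ * β)) := by gcongr
    refine s1.trans ?_
    have s2 : 3 * (θ * α + φ * β) * r - α * β * (3 * (φ * α + θ * β)) = 3 * (θ * α ^ 3 + φ * β ^ 3) := by
      rw [hrdef]; ring
    have s3 : 0 ≤ 3 * (θ * α ^ 3 + φ * β ^ 3) := by positivity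
    linarith
  have g2 : (α * θ) * (1 / (m * m) + 1 / (m * m)) ≤ 2 * 900000 ^ 3 * ((θ * α + φ * β) / r ^ 2) := by
    have h1 : (α * θ) * (1 / (m * m) + 1 / (m * m)) = 2 * 900000 ^ 2 * ((θ * α) / r ^ 2) := by
      rw [hm]; field_simp; norm_num
    rw [h1]
    have : 0 ≤ φ * β := by positivity
    have h3 : (θ * α) / r ^ 2 ≤ (θ * α + φ * β) / r ^ 2 := by gcongr; linarith
    have h4 : 0 ≤ (θ * α) / r ^ 2 := by positivity
    nlinarith
  refine (add_le_add g1 g2).trans (le_of_eq ?_)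
  unfold KF
  ring

lemma far_bd {φ θ α β : ℝ} (hφ : φ ∈ Icc (0:ℝ) 1) (hθ : θ ∈ Icc (0:ℝ) 1)
    (hα : α ∈ Ioo (3 * φ / 2) π) (hβ : β ∈ Ioo (3 * θ / 2) (π / 2)) :
    |2 * Pk (sc α β) - Gk φ θ (sc α β)| ≤
      KF * (θ * |α| / (α ^ 2 + β ^ 2) ^ 2 + φ * |β| / (β ^ 2 + α ^ 2) ^ 2) := by
  obtain ⟨ha0, ha'⟩ := hα
  obtain ⟨hb0, hb'⟩ := hβ
  obtain ⟨hφ0, hφ1⟩ := id hφ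
  obtain ⟨hθ0, hθ1⟩ := id hθ
  have ha : 0 < α := by linarith
  have hb : 0 < β := by linarith
  have hab1 : |α| ≤ π := by rw [abs_of_pos ha]; exact ha'.le
  have hab2 : |β| ≤ π / 2 := by rw [abs_of_pos hb]; exact hb'.le
  have d1 := dist_lb hφ hθ hab1 hab2
  have d2 := dist_lb hφ hθ (α := -α) (by rwa [abs_neg]) hab2
  have d3 := dist_lb hφ hθ (β := -β) hab1 (by rwa [abs_neg])
  have d4 := dist_lb hφ hθ (α := -α) (β := -β) (by rwa [abs_neg]) (by rwa [abs_neg])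
  have d0 := dist_lb (φ := 0) (θ := 0) (by simp) (by simp) hab1 hab2
  have f1 := D_diff hφ hθ α β
  have f2 := D_diff hφ hθ (-α) β
  have f3 := D_diff hφ hθ α (-β)
  have f4 := D_diff hφ hθ (-α) (-β)
  have hx0 : x₀ = sc 0 0 := by apply E3_ext <;> simp [x₀, sc]
  have hZ : ‖sc 0 0 - sc α β‖ ^ 2 = 2 - 2 * (cos β * cos α) := by
    rw [D_eq (sc_mem α β)]; simp [sc]
  have hP : Pk (sc α β) = (sc α β) 1 * (sc α β) 2 / (‖sc 0 0 - sc α β‖ ^ 2) ^ 2 := by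
    unfold Pk; rw [hx0, norm_sub_rev, ← pow_mul]
  simp only [cos_neg, abs_neg, abs_of_pos ha, abs_of_pos hb] at f1 f2 f3 f4
  rw [← hZ] at f1 f2 f3 f4
  rw [hP]
  unfold Gk
  rw [flip3_sc, flip2_sc, flip2_sc]
  have hs : 0 ≤ sin θ := sin_nonneg_of_nonneg_of_le_pi hθ0 (by linarith [pi_gt_three])
  have hs' : sin θ ≤ θ := sin_le hθ0
  have y1 : 0 ≤ (sc α β) 1 := by
    simp only [sc, vec3_1]
    exact mul_nonneg (cos_nonneg_of_mem_Icc ⟨by linarith, hb'.le⟩) (sin_nonneg_of_nonneg_of_le_pi ha.le ha'.le)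
  have y1' : (sc α β) 1 ≤ α := by
    simp only [sc, vec3_1]
    have := sin_nonneg_of_nonneg_of_le_pi ha.le ha'.le
    have := sin_le ha.le
    have := cos_le_one β
    nlinarith
  have y2 : 0 ≤ (sc α β) 2 := sin_nonneg_of_nonneg_of_le_pi hb.le (by linarith)
  have y2' : (sc α β) 2 ≤ β := sin_le hb.le
  obtain ⟨p1, p2⟩ := third_sq hφ0 ha0
  obtain ⟨p3, p4⟩ := third_sq hθ0 hb0
  rw [zero_sub, zero_sub, neg_sq, neg_sq] at d0
  exact far_real hφ0 hθ0 ha0 hb0 ha hb hs hs' y1 y1' y2 y2' (by linarith [sq_nonneg α, sq_nonneg β]) (by linarith)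
    (by linarith) (by linarith) (by linarith) f1 f2 f3 f4

lemma lbd {A : Set (ℝ × ℝ)} (hA : MeasurableSet A) {F g : ℝ × ℝ → ℝ} {c K : ℝ} (hc : 0 ≤ c)
    (h : ∀ p ∈ A, F p ≤ c * g p) (hI : ∫⁻ p in A, ENNReal.ofReal (g p) ≤ ENNReal.ofReal K) :
    ∫⁻ p in A, ENNReal.ofReal (F p) ≤ ENNReal.ofReal (c * K) := by
  calc _ ≤ ∫⁻ p in A, ENNReal.ofReal c * ENNReal.ofReal (g p) := by
        refine setLIntegral_mono' hA fun p hp => ?_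
        rw [← ENNReal.ofReal_mul hc]
        exact ENNReal.ofReal_le_ofReal (h p hp)
    _ = ENNReal.ofReal c * ∫⁻ p in A, ENNReal.ofReal (g p) := lintegral_const_mul' _ _ ENNReal.ofReal_ne_top
    _ ≤ _ := by rw [ENNReal.ofReal_mul hc]; gcongr

lemma ladd {A : Set (ℝ × ℝ)} (hA : MeasurableSet A) {F F1 F2 : ℝ × ℝ → ℝ} {K1 K2 : ℝ}
    (hF1 : Measurable F1) (h : ∀ p ∈ A, F p ≤ F1 p + F2 p)
    (h1 : ∫⁻ p in A, ENNReal.ofReal (F1 p) ≤ ENNReal.ofReal K1)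
    (h2 : ∫⁻ p in A, ENNReal.ofReal (F2 p) ≤ ENNReal.ofReal K2) (hK1 : 0 ≤ K1) (hK2 : 0 ≤ K2) :
    ∫⁻ p in A, ENNReal.ofReal (F p) ≤ ENNReal.ofReal (K1 + K2) := by
  calc _ ≤ ∫⁻ p in A, (ENNReal.ofReal (F1 p) + ENNReal.ofReal (F2 p)) := by
        refine setLIntegral_mono' hA fun p hp => ?_
        exact (ENNReal.ofReal_le_ofReal (h p hp)).trans ENNReal.ofReal_add_le
    _ = _ := lintegral_add_left (by fun_prop) _
    _ ≤ _ := by rw [ENNReal.ofReal_add hK1 hK2]; exact add_le_add h1 h2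

@[fun_prop] lemma hk_meas (φ θ : ℝ) : Measurable (fun p : ℝ × ℝ => hk φ p.1 (p.2 - θ)) := by
  unfold hk; fun_prop
@[fun_prop] lemma hk_meas' (φ θ : ℝ) : Measurable (fun p : ℝ × ℝ => hk φ p.1 (p.2 + θ)) := by
  unfold hk; fun_prop

lemma hk_nn {φ α t : ℝ} (ha : 0 < α) : 0 ≤ hk φ α t := by unfold hk; positivity

lemma Q_meas {a b : ℝ} (ha : 0 ≤ a) (hb : 0 ≤ b) : MeasurableSet (Qset a b) := by
  unfold Qset
  refine MeasurableSet.image_of_continuousOn_injOn (measurableSet_Ioo.prod measurableSet_Ioo) ?_ ?_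
  · exact (sc_lip).continuous.continuousOn
  · rintro ⟨α, β⟩ ⟨⟨h1, h2⟩, h3, h4⟩ ⟨α', β'⟩ ⟨⟨h1', h2'⟩, h3', h4'⟩ h
    simp only at *
    have e2 : (sc α β) 2 = (sc α' β') 2 := by rw [h]
    have e0 : (sc α β) 0 = (sc α' β') 0 := by rw [h]
    simp only [sc, vec3_2, vec3_0] at e2 e0
    have hβ : β = β' := injOn_sin ⟨by linarith, h4.le⟩ ⟨by linarith, h4'.le⟩ e2
    subst hβ
    have hc : 0 < cos β := cos_pos_of_mem_Ioo ⟨by linarith, h4⟩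
    have := mul_left_cancel₀ hc.ne' e0
    have hα : α = α' := injOn_cos ⟨by linarith, h2.le⟩ ⟨by linarith, h2'.le⟩ this
    rw [hα]

section
variable {φ θ : ℝ} {ω : E3 → ℝ} {W : ℝ}

lemma oG_bd (hφ : φ ∈ Icc (0:ℝ) 1) (hθ : θ ∈ Icc (0:ℝ) 1) (hW : ∀ y, |ω y| ≤ W)
    {α β : ℝ} (hα : α ∈ Ioo 0 π) (hβ : β ∈ Ioo 0 (π / 2)) :
    |ω (sc α β) * Gk φ θ (sc α β)| ≤
      |ω (sc α β)| * (10000000000 * hk φ α (β - θ)) + W * 10000000000 * hk φ α (β + θ) := by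
  rw [abs_mul]
  have h := mul_le_mul_of_nonneg_left (G_bd hφ hθ hα hβ) (abs_nonneg (ω (sc α β)))
  have h2 := mul_le_mul_of_nonneg_right (hW (sc α β)) (hk_nn (φ := φ) (t := β + θ) hα.1)
  linarith

lemma E_far (hφ : φ ∈ Icc (0:ℝ) 1) (hθ : θ ∈ Icc (0:ℝ) 1) (hW : ∀ y, |ω y| ≤ W) (hW0 : 0 ≤ W) :
    ∫⁻ p in Ioo (3 * φ / 2) π ×ˢ Ioo (3 * θ / 2) (π / 2),
      ENNReal.ofReal |ω (sc p.1 p.2) * (2 * Pk (sc p.1 p.2) - Gk φ θ (sc p.1 p.2))| ≤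
      ENNReal.ofReal (W * KF * 8) := by
  have hKF : 0 ≤ KF := by unfold KF; norm_num
  refine lbd (g := fun p => θ * |p.1| / (p.1 ^ 2 + p.2 ^ 2) ^ 2 + φ * |p.2| / (p.2 ^ 2 + p.1 ^ 2) ^ 2)
    (measurableSet_Ioo.prod measurableSet_Ioo) (by positivity) ?_ ?_
  · rintro ⟨α, β⟩ ⟨h1, h2⟩
    simp only at *
    rw [abs_mul, mul_assoc]
    exact mul_le_mul (hW _) (far_bd hφ hθ h1 h2) (abs_nonneg _) hW0
  · refine le_trans (lintegral_mono fun p => ENNReal.ofReal_add_le) ((I_far hφ.1 hθ.1).trans ?_)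
    exact ENNReal.ofReal_le_ofReal (by linarith [pi_le_four])

lemma E_one (hφ : φ ∈ Icc (0:ℝ) 1) (hθ : θ ∈ Icc (0:ℝ) 1) (hω : Measurable ω) (hW : ∀ y, |ω y| ≤ W) (hW0 : 0 ≤ W) :
    ∫⁻ p in Ioc 0 (3 * φ / 2) ×ˢ Ioo 0 (π / 2),
      ENNReal.ofReal |ω (sc p.1 p.2) * Gk φ θ (sc p.1 p.2)| ≤
      ENNReal.ofReal (W * 480000000000) := by
  have hA : MeasurableSet (Ioc 0 (3 * φ / 2) ×ˢ Ioo 0 (π / 2)) := measurableSet_Ioc.prod measurableSet_Ioo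
  have hpp : π * π ≤ 16 := by nlinarith [pi_le_four, pi_pos]
  have key : ∀ τ : ℝ, ∫⁻ p in Ioc 0 (3 * φ / 2) ×ˢ Ioo 0 (π / 2),
      ENNReal.ofReal (W * 10000000000 * hk φ p.1 (p.2 - τ)) ≤ ENNReal.ofReal ((W * 15000000000) * 16) := by
    intro τ
    refine lbd hA (by positivity) ?_ ((I_N1 _ _ φ τ).trans (ENNReal.ofReal_le_ofReal hpp))
    rintro ⟨α, β⟩ ⟨h1, h2⟩
    simp only at *
    have := hk_N1 (φ := φ) (t := β - τ) h1.1 h1.2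
    have h3 := mul_le_mul_of_nonneg_left this (by positivity : 0 ≤ W * 10000000000)
    rw [show (τ - β) ^ 2 = (β - τ) ^ 2 by ring]
    linarith
  have e : W * 480000000000 = W * 15000000000 * 16 + W * 15000000000 * 16 := by ring
  rw [e]
  have k2 := key (-θ)
  simp only [sub_neg_eq_add] at k2
  refine ladd hA (by fun_prop) ?_ (key θ) k2 (by positivity) (by positivity)
  rintro ⟨α, β⟩ ⟨h1, h2⟩
  simp only at *
  have hα : α ∈ Ioo 0 π := ⟨h1.1, by linarith [h1.2, hφ.2, pi_gt_three]⟩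
  refine (oG_bd hφ hθ hW hα h2).trans ?_
  have := mul_le_mul_of_nonneg_right (hW (sc α β)) (hk_nn (φ := φ) (t := β - θ) hα.1)
  linarith

lemma E_plus (hφ : φ ∈ Icc (0:ℝ) 1) (hθ : 0 < θ) (hW0 : 0 ≤ W) (t : ℝ → ℝ)  :
    ∫⁻ p in Ioo (3 * φ / 2) π ×ˢ Ioc 0 (3 * θ / 2),
      ENNReal.ofReal (W * 10000000000 * (9 / θ * (|θ| / ((0 - p.1) ^ 2 + θ ^ 2)))) ≤
      ENNReal.ofReal (W * 540000000000) := by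
  have hA : MeasurableSet (Ioo (3 * φ / 2) π ×ˢ Ioc 0 (3 * θ / 2)) := measurableSet_Ioo.prod measurableSet_Ioc
  have e : W * 540000000000 = (W * 10000000000 * (9 / θ)) * (4 * (3 * θ / 2 - 0)) := by
    field_simp; ring
  rw [e]
  refine lbd hA (by positivity) (g := fun p => |θ| / ((0 - p.1) ^ 2 + θ ^ 2)) ?_ ?_
  · intro p _
    exact le_of_eq (by ring)
  · refine (lintegral_mono_set (Set.prod_mono le_rfl Ioc_subset_Icc_self)).trans
      ((I_c (Ioo (3 * φ / 2) π) 0 (3 * θ / 2) (fun _ => θ) (by fun_prop) 0 (by linarith)).trans ?_)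
    refine ENNReal.ofReal_le_ofReal ?_
    exact mul_le_mul_of_nonneg_right pi_le_four (by linarith)

lemma E_log (hφ : φ ∈ Icc (0:ℝ) 1) (hφ0 : 0 < φ) (hθ : θ ∈ Icc (0:ℝ) 1) (hω : Measurable ω)
    (hW : ∀ y, |ω y| ≤ W) (hW0 : 0 ≤ W) :
    ∫⁻ p in Ioo (3 * φ / 2) π ×ˢ Ioc 0 (3 * θ / 2),
      ENNReal.ofReal |ω (sc p.1 p.2) * Gk φ θ (sc p.1 p.2)| ≤
      ENNReal.ofReal (W * 90000000000 * (2 * log (1 + θ / φ)) + W * 540000000000) := by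
  rcases hθ.1.eq_or_lt with h | h
  · rw [← h]; simp
  have hA : MeasurableSet (Ioo (3 * φ / 2) π ×ˢ Ioc 0 (3 * θ / 2)) := measurableSet_Ioo.prod measurableSet_Ioc
  have hl : 0 ≤ log (1 + θ / φ) := log_nonneg (by linarith [div_nonneg h.le hφ0.le])
  refine ladd hA (F1 := fun p => W * 90000000000 * (1 / (p.1 + |p.2 - θ|) ^ 2)) (by fun_prop) ?_ ?_
    (E_plus hφ h hW0 id) (by positivity) (by positivity)
  · rintro ⟨α, β⟩ ⟨⟨h1, h1'⟩, h2, h2'⟩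
    simp only at *
    have hα : α ∈ Ioo 0 π := ⟨by linarith, h1'⟩
    refine (oG_bd hφ hθ hW hα ⟨h2, by linarith [hθ.2, pi_gt_three]⟩).trans ?_
    have t1 := mul_le_mul_of_nonneg_right (hW (sc α β)) (hk_nn (φ := φ) (t := β - θ) hα.1)
    have t2 := mul_le_mul_of_nonneg_left (hk_log (t := β - θ) hφ0.le h1) hW0
    have t3 := mul_le_mul_of_nonneg_left (hk_far (t := β + θ) hφ0.le h h1
      (Or.inl (by rw [abs_of_pos (by linarith)]; linarith))) (by positivity : 0 ≤ W * 10000000000)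
    linarith
  · refine lbd hA (by positivity) (fun p _ => le_rfl) ?_
    refine (lintegral_mono_set (Set.prod_mono ?_ le_rfl)).trans (I_log hφ0 hθ.1)
    intro x hx
    have := hx.1
    simp only [mem_Ioi]; linarith

lemma E_lip (hφ : φ ∈ Icc (0:ℝ) 1) (hφ0 : 0 < φ) (hθ : θ ∈ Icc (0:ℝ) 1) (hω : Measurable ω)
    (hW : ∀ y, |ω y| ≤ W) (hW0 : 0 ≤ W) (hodd : OddOdd ω) (M : ℝ≥0)
    (hM : LipschitzOnWith M (fun p : ℝ × ℝ => ω (sc p.1 p.2))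
              (Icc (0:ℝ) (3 * θ / 2) ×ˢ Icc (0:ℝ) (3 * θ / 2))) :
    ∫⁻ p in Ioo (3 * φ / 2) π ×ˢ Ioc 0 (3 * θ / 2),
      ENNReal.ofReal |ω (sc p.1 p.2) * Gk φ θ (sc p.1 p.2)| ≤
      ENNReal.ofReal (M * 90000000000 * (4 * (3 * θ / 2 - 0)) + (W * 540000000000 + W * 540000000000)) := by
  rcases hθ.1.eq_or_lt with h | h
  · rw [← h]; simp
  have hA : MeasurableSet (Ioo (3 * φ / 2) π ×ˢ Ioc 0 (3 * θ / 2)) := measurableSet_Ioo.prod measurableSet_Ioc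
  have hM0 : (0:ℝ) ≤ M := M.2
  refine ladd hA (F1 := fun p => M * 90000000000 * (|p.2 - θ| / ((0 - p.1) ^ 2 + (p.2 - θ) ^ 2))) (by fun_prop) ?_ ?_
    (ladd hA (by fun_prop) (fun p _ => le_rfl) (E_plus hφ h hW0 id) (E_plus hφ h hW0 id) (by positivity) (by positivity))
    (mul_nonneg (by positivity) (by linarith)) (by positivity)
  · rintro ⟨α, β⟩ ⟨⟨h1, h1'⟩, h2, h2'⟩
    simp only at *
    have hα : α ∈ Ioo 0 π := ⟨by linarith, h1'⟩
    refine (oG_bd hφ hθ hW hα ⟨h2, by linarith [hθ.2, pi_gt_three]⟩).trans ?_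
    have t3 := mul_le_mul_of_nonneg_left (hk_far (t := β + θ) hφ0.le h h1
      (Or.inl (by rw [abs_of_pos (by linarith)]; linarith))) (by positivity : 0 ≤ W * 10000000000)
    rcases le_or_gt α (3 * θ / 2) with hc | hc
    · have hz : ω (sc 0 β) = 0 := by
        have := (hodd (sc 0 β) (sc_mem _ _)).1
        rw [flip2_sc, neg_zero] at this
        linarith
      have hd := hM.dist_le_mul (α, β) ⟨⟨hα.1.le, hc⟩, h2.le, h2'⟩ (0, β) ⟨⟨le_rfl, by linarith⟩, h2.le, h2'⟩
      have hdd : dist ((α, β) : ℝ × ℝ) (0, β) = α := by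
        rw [Prod.dist_eq]; simp [abs_of_pos hα.1, hα.1.le]
      simp only [hdd, Real.dist_eq, hz, sub_zero] at hd
      have t1 := mul_le_mul_of_nonneg_right hd (hk_nn (φ := φ) (t := β - θ) hα.1)
      have t2 := mul_le_mul_of_nonneg_left (hk_lip (t := β - θ) hφ0.le h1) hM0
      have t4 : 0 ≤ W * 10000000000 * (9 / θ * (|θ| / ((0 - α) ^ 2 + θ ^ 2))) := by positivity
      linarith
    · have t1 := mul_le_mul_of_nonneg_right (hW (sc α β)) (hk_nn (φ := φ) (t := β - θ) hα.1)
      have t2 := mul_le_mul_of_nonneg_left (hk_far (t := β - θ) hφ0.le h h1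
        (Or.inr (by linarith))) (by positivity : 0 ≤ W * 10000000000)
      have t4 : 0 ≤ M * 90000000000 * (|β - θ| / ((0 - α) ^ 2 + (β - θ) ^ 2)) := by positivity
      linarith
  · refine lbd hA (by positivity) (fun p _ => le_rfl) ?_
    refine (lintegral_mono_set (Set.prod_mono le_rfl Ioc_subset_Icc_self)).trans
      ((I_c (Ioo (3 * φ / 2) π) 0 (3 * θ / 2) (fun b => b - θ) (by fun_prop) 0 (by linarith)).trans ?_)
    refine ENNReal.ofReal_le_ofReal ?_
    exact mul_le_mul_of_nonneg_right pi_le_four (by linarith)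

lemma core (hφ : φ ∈ Icc (0:ℝ) 1) (hφ0 : 0 < φ) (hθ : θ ∈ Icc (0:ℝ) 1) (hω : Measurable ω)
    (hW : ∀ y, |ω y| ≤ W) (hW0 : 0 ≤ W) (hodd : OddOdd ω) {E2 : ℝ} (hE0 : 0 ≤ E2)
    (hE2 : ∫⁻ p in Ioo (3 * φ / 2) π ×ˢ Ioc 0 (3 * θ / 2),
      ENNReal.ofReal |ω (sc p.1 p.2) * Gk φ θ (sc p.1 p.2)| ≤ ENNReal.ofReal E2) :
    |dot3 (biotSavart ω (sc φ θ)) (ephi (sc φ θ)) +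
                ((sc φ θ) 1 / sqrt (1 - ((sc φ θ) 2) ^ 2)) * ((4 / Real.pi) *
                  ∫ y in Qset (3 * φ / 2) (3 * θ / 2),
                    y 1 * y 2 / ‖y - x₀‖ ^ 4 * ω y ∂sigma2)| ≤
      sin φ * (8 * (W * KF * 8 + (W * 480000000000 + E2))) := by
  have hKF : 0 ≤ KF := by unfold KF; norm_num
  obtain ⟨hint, heq⟩ := symm_main hφ hθ hω hW hodd
  have hs : 0 < sin φ := sin_pos_of_pos_of_lt_pi hφ0 (by linarith [hφ.2, pi_gt_three])
  rw [pref hθ, heq, integral_const_mul]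
  have hG : IntegrableOn (fun y => ω y * Gk φ θ y) S2q sigma2 := by
    have := hint.const_mul (-(4 * sin φ))⁻¹
    refine this.congr (Eventually.of_forall fun y => ?_)
    simp only
    rw [inv_mul_cancel_left₀]
    linarith
  set Q := Qset (3 * φ / 2) (3 * θ / 2) with hQ
  have hQm : MeasurableSet Q := Q_meas (by linarith) (by linarith [hθ.1])
  have hQs : Q ⊆ S2q := by
    rw [S2q_eq, hQ, Qset]
    exact image_mono (Set.prod_mono (Ioo_subset_Ioo_left (by linarith)) (Ioo_subset_Ioo_left (by linarith [hθ.1])))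
  have hfar : ∫⁻ y in Q, ‖ω y * (2 * Pk y - Gk φ θ y)‖ₑ ∂sigma2 ≤ ENNReal.ofReal (4 * (W * KF * 8)) := by
    refine (lint_le _ _ (by fun_prop)).trans ?_
    rw [ENNReal.ofReal_mul (by norm_num)]
    simp only [Real.enorm_eq_ofReal_abs]
    rw [show ENNReal.ofReal 4 = 4 by simp]
    gcongr
    exact E_far hφ hθ hW hW0
  have hR : ∫⁻ y in S2q \ Q, ‖ω y * Gk φ θ y‖ₑ ∂sigma2 ≤ ENNReal.ofReal (4 * (W * 480000000000 + E2)) := by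
    have hsub : S2q \ Q ⊆ (fun p : ℝ × ℝ => sc p.1 p.2) '' (Ioc 0 (3 * φ / 2) ×ˢ Ioo 0 (π / 2)) ∪
        (fun p : ℝ × ℝ => sc p.1 p.2) '' (Ioo (3 * φ / 2) π ×ˢ Ioc 0 (3 * θ / 2)) := by
      rintro y ⟨hy, hyQ⟩
      rw [S2q_eq] at hy
      obtain ⟨⟨α, β⟩, ⟨⟨h1, h2⟩, h3, h4⟩, rfl⟩ := hy
      simp only at h1 h2 h3 h4
      rcases le_or_gt α (3 * φ / 2) with hc | hc
      · exact Or.inl ⟨(α, β), ⟨⟨h1, hc⟩, h3, h4⟩, rfl⟩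
      · rcases le_or_gt β (3 * θ / 2) with hd | hd
        · exact Or.inr ⟨(α, β), ⟨⟨hc, h2⟩, h3, hd⟩, rfl⟩
        · exact absurd ⟨(α, β), ⟨⟨hc, h2⟩, hd, h4⟩, rfl⟩ hyQ
    refine (lintegral_mono_set hsub).trans ((lintegral_union_le _ _ _).trans ?_)
    refine (add_le_add (lint_le _ _ (by fun_prop)) (lint_le _ _ (by fun_prop))).trans ?_
    rw [ENNReal.ofReal_mul (by norm_num), ENNReal.ofReal_add (by positivity) hE0, mul_add]
    simp only [Real.enorm_eq_ofReal_abs]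
    rw [show ENNReal.ofReal 4 = 4 by simp]
    gcongr
    exact E_one hφ hθ hω hW hW0
  have hHint : IntegrableOn (fun y => ω y * (2 * Pk y - Gk φ θ y)) Q sigma2 :=
    ⟨by fun_prop, lt_of_le_of_lt hfar ENNReal.ofReal_lt_top⟩
  have hGQ : IntegrableOn (fun y => ω y * Gk φ θ y) Q sigma2 := hG.mono_set hQs
  have e1 : ∫ y in Q, y 1 * y 2 / ‖y - x₀‖ ^ 4 * ω y ∂sigma2 =
      2⁻¹ * (∫ y in Q, ω y * (2 * Pk y - Gk φ θ y) ∂sigma2 + ∫ y in Q, ω y * Gk φ θ y ∂sigma2) := by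
    rw [← integral_add hHint hGQ, ← integral_const_mul]
    refine integral_congr_ae (Eventually.of_forall fun y => ?_)
    simp only [Pk]; ring
  have e2 : ∫ y in S2q, ω y * Gk φ θ y ∂sigma2 =
      ∫ y in Q, ω y * Gk φ θ y ∂sigma2 + ∫ y in S2q \ Q, ω y * Gk φ θ y ∂sigma2 := by
    have := integral_inter_add_sdiff hQm hG
    rw [inter_eq_right.2 hQs] at this
    exact this.symm
  have b1 : |∫ y in Q, ω y * (2 * Pk y - Gk φ θ y) ∂sigma2| ≤ 4 * (W * KF * 8) := by
    have := (enorm_integral_le_lintegral_enorm _).trans hfar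
    rw [Real.enorm_eq_ofReal_abs] at this
    exact (ENNReal.ofReal_le_ofReal_iff (by positivity)).1 this
  have b2 : |∫ y in S2q \ Q, ω y * Gk φ θ y ∂sigma2| ≤ 4 * (W * 480000000000 + E2) := by
    have := (enorm_integral_le_lintegral_enorm _).trans hR
    rw [Real.enorm_eq_ofReal_abs] at this
    exact (ENNReal.ofReal_le_ofReal_iff (by positivity)).1 this
  rw [e1, e2]
  generalize ∫ y in Q, ω y * (2 * Pk y - Gk φ θ y) ∂sigma2 = a at *
  generalize ∫ y in S2q \ Q, ω y * Gk φ θ y ∂sigma2 = b at *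
  generalize ∫ y in Q, ω y * Gk φ θ y ∂sigma2 = g at *
  have e3 : (2 * π)⁻¹ * (-(4 * sin φ) * (g + b)) + sin φ * (4 / π * (2⁻¹ * (a + g))) = sin φ * (2 / π * (a - b)) := by
    field_simp; ring
  rw [e3, abs_mul, abs_of_pos hs, abs_mul, abs_of_pos (by positivity : 0 < 2 / π)]
  have h2 : 2 / π ≤ 1 := by rw [div_le_one pi_pos]; linarith [pi_gt_three]
  refine mul_le_mul_of_nonneg_left ?_ hs.le
  have h3 : |a - b| ≤ |a| + |b| := abs_sub a b
  calc _ ≤ 1 * |a - b| := mul_le_mul_of_nonneg_right h2 (abs_nonneg _)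
    _ ≤ _ := by linarith [abs_nonneg a, abs_nonneg b]
end



/-- Key velocity estimate (Lemma 2.1), `φ`-component. The bound by the
minimum of the two expressions is phrased as a conjunction: the first (logarithmic) bound
applies whenever `φ ≠ 0` (when `φ = 0` that expression is `+∞`), and the second bound
applies for every Lipschitz constant `M` of `ω̃` on `[0, 3θ/2]²`. -/
theorem velocity_estimate_phi :
    ∃ C₁ : ℝ, 1 ≤ C₁ ∧
      ∀ (ω : E3 → ℝ) (W : ℝ), Measurable ω → (∀ y, |ω y| ≤ W) → OddOdd ω →
        ∀ φ ∈ Icc (0:ℝ) 1, ∀ θ ∈ Icc (0:ℝ) 1, (φ, θ) ≠ (0, 0) →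
          (φ ≠ 0 →
            |dot3 (biotSavart ω (sc φ θ)) (ephi (sc φ θ)) +
                ((sc φ θ) 1 / sqrt (1 - ((sc φ θ) 2) ^ 2)) * ((4 / Real.pi) *
                  ∫ y in Qset (3 * φ / 2) (3 * θ / 2),
                    y 1 * y 2 / ‖y - x₀‖ ^ 4 * ω y ∂sigma2)| ≤
              ((sc φ θ) 1 / sqrt (1 - ((sc φ θ) 2) ^ 2)) * C₁ *
                (W * (1 + log (1 + θ / φ)))) ∧
          (∀ M : ℝ≥0,
            LipschitzOnWith M (fun p : ℝ × ℝ => ω (sc p.1 p.2))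
              (Icc (0:ℝ) (3 * θ / 2) ×ˢ Icc (0:ℝ) (3 * θ / 2)) →
            |dot3 (biotSavart ω (sc φ θ)) (ephi (sc φ θ)) +
                ((sc φ θ) 1 / sqrt (1 - ((sc φ θ) 2) ^ 2)) * ((4 / Real.pi) *
                  ∫ y in Qset (3 * φ / 2) (3 * θ / 2),
                    y 1 * y 2 / ‖y - x₀‖ ^ 4 * ω y ∂sigma2)| ≤
              ((sc φ θ) 1 / sqrt (1 - ((sc φ θ) 2) ^ 2)) * C₁ * (W + M * θ)) := by
  have hKF : 0 ≤ KF := by unfold KF; norm_num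
  refine ⟨64 * KF + 100000000000000, by linarith, ?_⟩
  intro ω W hω hW hodd φ hφ θ hθ _
  have hW0 : 0 ≤ W := (abs_nonneg _).trans (hW 0)
  have hWK : 0 ≤ KF * W := mul_nonneg hKF hW0
  have hpos : φ ≠ 0 → 0 < φ := fun h => lt_of_le_of_ne hφ.1 (Ne.symm h)
  have hsn : 0 ≤ sin φ := sin_nonneg_of_nonneg_of_le_pi hφ.1 (by linarith [hφ.2, pi_gt_three])
  constructor
  · intro h
    have hφ0 := hpos h
    have hl : 0 ≤ log (1 + θ / φ) := log_nonneg (by linarith [div_nonneg hθ.1 hφ0.le])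
    refine (core hφ hφ0 hθ hω hW hW0 hodd (by positivity) (E_log hφ hφ0 hθ hω hW hW0)).trans ?_
    rw [pref hθ, mul_assoc (sin φ)]
    refine mul_le_mul_of_nonneg_left ?_ hsn
    have h1 : 0 ≤ W * log (1 + θ / φ) := mul_nonneg hW0 hl
    have h2 : 0 ≤ KF * (W * log (1 + θ / φ)) := mul_nonneg hKF h1
    linarith
  · intro M hM
    rcases eq_or_ne φ 0 with h | h
    · obtain ⟨_, heq⟩ := symm_main hφ hθ hω hW hodd
      rw [pref hθ, heq, h]
      simp
    · have hφ0 := hpos h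
      have hM0 : (0:ℝ) ≤ M := M.2
      have h1 : 0 ≤ M * θ := mul_nonneg hM0 hθ.1
      have h2 : 0 ≤ KF * (M * θ) := mul_nonneg hKF h1
      refine (core hφ hφ0 hθ hω hW hW0 hodd ?_ (E_lip hφ hφ0 hθ hω hW hW0 hodd M hM)).trans ?_
      · linarith
      rw [pref hθ, mul_assoc (sin φ)]
      refine mul_le_mul_of_nonneg_left ?_ hsn
      linarith
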